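/- arXiv:1310.1789 — 4 statements merged into one kernel-verified Lean document; each statement's English description precedes it below -/
import Mathlib

section
/- Let t ∈ ℝ and q ≥ 0. (1) If t > γ(q), then there is a constant C = C(t,q) < ∞ such that Σ_{i∈I_δ} ψ^{t,q}(i) ≤ C for all δ ∈ (0,1]. (2) If t < γ(q), then there is a constant c = c(t,q) > 0 such that Σ_{i∈I_δ} ψ^{t,q}(i) ≥ c for all δ ∈ (0,1]. -/
open MeasureTheory Filter Set

attribute [local instance] Classical.propDecidable

noncomputable section

/-- Data of a box-like planar self-affine IFS: each map is `S i = T i ∘ L i + t i`, where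
`T i` is the diagonal contraction `diag (c i, d i)` with `c i, d i ∈ (0,1)` and `L i` is a
linear isometry of the plane preserving `[-1,1]²`, i.e. one of the eight symmetries of the
square, encoded by whether it swaps the two axes (`swap`) and by a sign on each coordinate. -/
structure IFSData (ι : Type) where
  c : ι → ℝ
  d : ι → ℝ
  swap : ι → Bool
  sgn1 : ι → Bool
  sgn2 : ι → Bool
  t : ι → ℝ × ℝ

namespace IFSData

variable {ι : Type}

/-- The affine contraction `S i = T i ∘ L i + t i`. -/
def S (B : IFSData ι) (i : ι) (x : ℝ × ℝ) : ℝ × ℝ :=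
  ((if B.sgn1 i then 1 else -1) * (B.c i * (if B.swap i then x.2 else x.1)) + (B.t i).1,
   (if B.sgn2 i then 1 else -1) * (B.d i * (if B.swap i then x.1 else x.2)) + (B.t i).2)

/-- `(b(i), h(i))`: base and height of the rectangle `S_i([0,1]²)` for a finite word `i`. -/
def dims (B : IFSData ι) (l : List ι) : ℝ × ℝ :=
  l.foldr (fun i w =>
    (B.c i * (if B.swap i then w.2 else w.1), B.d i * (if B.swap i then w.1 else w.2))) (1, 1)

/-- `α₁(i)`: the larger singular value of the linear part of `S_i`. -/
def alpha1 (B : IFSData ι) (l : List ι) : ℝ := max (B.dims l).1 (B.dims l).2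

/-- `α₂(i)`: the smaller singular value of the linear part of `S_i`. -/
def alpha2 (B : IFSData ι) (l : List ι) : ℝ := min (B.dims l).1 (B.dims l).2

/-- Whether the composite map of the word maps horizontal lines to vertical lines. -/
def swapW (B : IFSData ι) (l : List ι) : Bool := l.foldr (fun i b => xor (B.swap i) b) false

/-- The composite map `S_{i₁} ∘ ⋯ ∘ S_{i_k}` of a word. -/
def Sw (B : IFSData ι) (l : List ι) : ℝ × ℝ → ℝ × ℝ := l.foldr (fun i f => B.S i ∘ f) id

/-- The word `i` projects onto the first coordinate, i.e. `π_i = π₁`. -/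
def usesPi1 (B : IFSData ι) (l : List ι) : Prop :=
  (B.swapW l = false ∧ (B.dims l).2 ≤ (B.dims l).1) ∨
    (B.swapW l = true ∧ (B.dims l).1 < (B.dims l).2)

/-- The projection `π_i` onto the direction of the longest side of `S_i([0,1]²)`. -/
def projW (B : IFSData ι) (l : List ι) : ℝ × ℝ → ℝ :=
  if B.usesPi1 l then Prod.fst else Prod.snd

/-- The rectangular open set condition. -/
def ROSC (B : IFSData ι) : Prop :=
  ∃ x₁ x₂ y₁ y₂ : ℝ, x₁ < x₂ ∧ y₁ < y₂ ∧
    (∀ i, B.S i '' (Set.Ioo x₁ x₂ ×ˢ Set.Ioo y₁ y₂) ⊆ Set.Ioo x₁ x₂ ×ˢ Set.Ioo y₁ y₂) ∧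
    Pairwise fun i j =>
      Disjoint (B.S i '' (Set.Ioo x₁ x₂ ×ˢ Set.Ioo y₁ y₂))
        (B.S j '' (Set.Ioo x₁ x₂ ×ˢ Set.Ioo y₁ y₂))

end IFSData

/-- `p(i)`: the probability of a finite word. -/
def wordProb {ι : Type} (p : ι → ℝ) (l : List ι) : ℝ := (l.map p).prod

/-- `τ_i(q)`: the value of the `L^q`-spectrum of the projection `π_i μ`. -/
def tauW {ι : Type} (B : IFSData ι) (τ1 τ2 : ℝ → ℝ) (l : List ι) (q : ℝ) : ℝ :=
  if B.usesPi1 l then τ1 q else τ2 q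

/-- The `q`-modified singular value function `ψ^{s,q}`. -/
def psiSV {ι : Type} (B : IFSData ι) (p : ι → ℝ) (τ1 τ2 : ℝ → ℝ) (s q : ℝ) (l : List ι) : ℝ :=
  wordProb p l ^ q * B.alpha1 l ^ tauW B τ1 τ2 l q * B.alpha2 l ^ (s - tauW B τ1 τ2 l q)

/-- `Ψ_k^{s,q} = ∑_{i ∈ I^k} ψ^{s,q}(i)`. -/
def PsiSV {ι : Type} [Fintype ι] (B : IFSData ι) (p : ι → ℝ) (τ1 τ2 : ℝ → ℝ)
    (k : ℕ) (s q : ℝ) : ℝ :=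
  ∑ f : Fin k → ι, psiSV B p τ1 τ2 s q (List.ofFn f)

/-- The lower `L^q`-spectrum of a measure. -/
def lowerLq {X : Type*} [MeasurableSpace X] [PseudoMetricSpace X] (ν : Measure X) (q : ℝ) : ℝ :=
  liminf (fun δ : ℝ =>
      Real.log (∫ x, (ν (Metric.ball x δ)).toReal ^ (q - 1) ∂ν) / (-Real.log δ))
    (nhdsWithin 0 (Set.Ioi 0))

/-- The upper `L^q`-spectrum of a measure. -/
def upperLq {X : Type*} [MeasurableSpace X] [PseudoMetricSpace X] (ν : Measure X) (q : ℝ) : ℝ :=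
  limsup (fun δ : ℝ =>
      Real.log (∫ x, (ν (Metric.ball x δ)).toReal ^ (q - 1) ∂ν) / (-Real.log δ))
    (nhdsWithin 0 (Set.Ioi 0))

/-- The `L^q`-spectrum of `ν` exists and equals `t`. -/
def IsLqSpec {X : Type*} [MeasurableSpace X] [PseudoMetricSpace X]
    (ν : Measure X) (q t : ℝ) : Prop :=
  lowerLq ν q = t ∧ upperLq ν q = t

/-- `α_min = min_{i ∈ I} α₂(i)`. -/
def alphaMin {ι : Type} [Fintype ι] [Nonempty ι] (B : IFSData ι) : ℝ :=
  Finset.univ.inf' Finset.univ_nonempty fun i => min (B.c i) (B.d i)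

/-- `α_max = max_{i ∈ I} α₁(i)`. -/
def alphaMax {ι : Type} [Fintype ι] [Nonempty ι] (B : IFSData ι) : ℝ :=
  Finset.univ.sup' Finset.univ_nonempty fun i => max (B.c i) (B.d i)

/-- `p_max = max_{i ∈ I} p_i`. -/
def pMax {ι : Type} [Fintype ι] [Nonempty ι] (p : ι → ℝ) : ℝ :=
  Finset.univ.sup' Finset.univ_nonempty p

/-- The `δ`-stopping `I_δ`. -/
def stopping {ι : Type} (B : IFSData ι) (δ : ℝ) : Set (List ι) :=
  {l | l ≠ [] ∧ B.alpha2 l < δ ∧ δ ≤ B.alpha2 l.dropLast}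


/-- The lower integral defining the `L^q` spectrum. -/
def Jq (ν : Measure ℝ) (q δ : ℝ) : ENNReal := ∫⁻ x, ν (Metric.ball x δ) ^ (q - 1) ∂ν

/-- Polynomial lower bound on the mass of balls. -/
def MassBd {X : Type} [MeasurableSpace X] [PseudoMetricSpace X] (ν : Measure X) (c M : ℝ) : Prop :=
  ∀ δ ∈ Set.Ioc (0 : ℝ) 1, ∀ᵐ x ∂ν, ENNReal.ofReal (c * δ ^ M) ≤ ν (Metric.ball x δ)

lemma meas_ball (ν : Measure ℝ) [IsProbabilityMeasure ν] (δ : ℝ) :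
    Measurable fun x => ν (Metric.ball x δ) := by
  have : MeasurableSet {z : ℝ × ℝ | dist z.2 z.1 < δ} :=
    measurableSet_lt (measurable_snd.dist measurable_fst) measurable_const
  exact measurable_measure_prodMk_left this

lemma S_lip {ι : Type} (B : IFSData ι) (a : ℝ) (i : ι) (hc0 : 0 < B.c i) (hd0 : 0 < B.d i)
    (hca : B.c i ≤ a) (hda : B.d i ≤ a) (x y : ℝ × ℝ) :
    dist (B.S i x) (B.S i y) ≤ a * dist x y := by
  have ha : 0 ≤ a := hc0.le.trans hca
  have h1 : |x.1 - y.1| ≤ dist x y := by rw [Prod.dist_eq, Real.dist_eq]; exact le_max_left _ _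
  have h2 : |x.2 - y.2| ≤ dist x y := by
    rw [Prod.dist_eq, Real.dist_eq, Real.dist_eq]; exact le_max_right _ _
  have key : ∀ (e c t u v D : ℝ), |e| = 1 → 0 < c → c ≤ a → |u - v| ≤ D →
      |e * (c * u) + t - (e * (c * v) + t)| ≤ a * D := by
    intro e c t u v D he hc hca h
    have : e * (c * u) + t - (e * (c * v) + t) = e * (c * (u - v)) := by ring
    rw [this, abs_mul, he, one_mul, abs_mul, abs_of_pos hc]
    exact mul_le_mul hca h (abs_nonneg _) ha
  rw [Prod.dist_eq, max_le_iff, Real.dist_eq, Real.dist_eq]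
  unfold IFSData.S
  constructor
  · apply key _ _ _ _ _ _ _ hc0 hca
    · split_ifs <;> assumption
    · split_ifs <;> simp
  · apply key _ _ _ _ _ _ _ hd0 hda
    · split_ifs <;> assumption
    · split_ifs <;> simp

lemma S_meas {ι : Type} (B : IFSData ι) (i : ι) : Measurable (B.S i) := by
  unfold IFSData.S
  cases B.swap i <;> cases B.sgn1 i <;> cases B.sgn2 i <;> simp <;> fun_prop

lemma mass_mu {ι : Type} [Fintype ι] [Nonempty ι] (B : IFSData ι)
    (hc : ∀ i, B.c i ∈ Set.Ioo (0 : ℝ) 1) (hd : ∀ i, B.d i ∈ Set.Ioo (0 : ℝ) 1)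
    (p : ι → ℝ) (hp : ∀ i, p i ∈ Set.Ioo (0 : ℝ) 1)
    (μ : Measure (ℝ × ℝ)) [IsProbabilityMeasure μ]
    (hcpt : ∃ K : Set (ℝ × ℝ), IsCompact K ∧ μ Kᶜ = 0)
    (hself : μ = ∑ i : ι, ENNReal.ofReal (p i) • Measure.map (B.S i) μ) :
    ∃ c M : ℝ, 0 < c ∧ 0 < M ∧ MassBd μ c M := by
  obtain ⟨i0, hi0⟩ := Finite.exists_max fun i => max (B.c i) (B.d i)
  obtain ⟨i1, hi1⟩ := Finite.exists_min p
  set a := max (B.c i0) (B.d i0) with ha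
  set r := p i1 with hr
  have ha0 : 0 < a := lt_max_of_lt_left (hc i0).1
  have ha1 : a < 1 := max_lt (hc i0).2 (hd i0).2
  have hr0 : 0 < r := (hp i1).1
  have hr1 : r < 1 := (hp i1).2
  have hac : ∀ i, B.c i ≤ a := fun i => (le_max_left _ _).trans (hi0 i)
  have had : ∀ i, B.d i ≤ a := fun i => (le_max_right _ _).trans (hi0 i)
  obtain ⟨K, hK, hK0⟩ := hcpt
  obtain ⟨R0, hR0⟩ := hK.isBounded.subset_ball (0 : ℝ × ℝ)
  set R := max R0 1 * 2 with hR
  have hR1 : 1 ≤ R := by have := le_max_right R0 1; linarith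
  have hpμ : ∀ i (s : Set (ℝ × ℝ)), MeasurableSet s →
      ENNReal.ofReal (p i) * μ (B.S i ⁻¹' s) ≤ μ s := by
    intro i s hs
    conv_rhs => rw [hself]
    rw [Measure.finsetSum_apply]
    refine le_trans ?_ (Finset.single_le_sum
      (f := fun i => (ENNReal.ofReal (p i) • Measure.map (B.S i) μ) s) (fun _ _ => zero_le) (Finset.mem_univ i))
    simp [Measure.map_apply (S_meas B i) hs]
  have step : ∀ k : ℕ, ∀ᵐ x ∂μ, ENNReal.ofReal (r ^ k) ≤ μ (Metric.ball x (R * a ^ k)) := by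
    intro k
    induction k with
    | zero =>
      have : ∀ᵐ x ∂μ, x ∈ K := by rw [ae_iff]; exact hK0
      filter_upwards [this] with x hx
      have h1 : K ⊆ Metric.ball x (R * a ^ 0) := by
        intro y hy
        have h1 := hR0 hx
        have h2 := hR0 hy
        rw [Metric.mem_ball] at *
        have := dist_triangle_right y x 0
        have := le_max_left R0 1
        rw [pow_zero]; linarith
      have h2 : μ K = 1 := (prob_compl_eq_zero_iff hK.measurableSet).1 hK0
      simp only [pow_zero, ENNReal.ofReal_one] at *
      rw [← h2]; exact measure_mono h1
    | succ k ih =>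
      rw [hself, ae_iff, Measure.finsetSum_apply]
      refine Finset.sum_eq_zero fun i _ => ?_
      rw [Measure.smul_apply, smul_eq_mul]
      refine mul_eq_zero_of_right _ ?_
      rw [← hself]
      change ∀ᵐ x ∂(Measure.map (B.S i) μ), ENNReal.ofReal (r ^ (k+1)) ≤ μ (Metric.ball x (R * a ^ (k+1)))
      have hms : MeasurableSet {z : (ℝ × ℝ) × (ℝ × ℝ) | dist z.2 z.1 < R * a ^ (k+1)} :=
        measurableSet_lt (measurable_snd.dist measurable_fst) measurable_const
      have hm : Measurable fun x : ℝ × ℝ => μ (Metric.ball x (R * a ^ (k+1))) :=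
        measurable_measure_prodMk_left hms
      rw [ae_map_iff (S_meas B i).aemeasurable (measurableSet_le measurable_const hm)]
      filter_upwards [ih] with y hy
      refine le_trans ?_ (hpμ i _ measurableSet_ball)
      rw [pow_succ', ENNReal.ofReal_mul hr0.le]
      gcongr
      · exact hi1 i
      · refine hy.trans (measure_mono ?_)
        intro z hz
        rw [Metric.mem_ball] at hz
        rw [Set.mem_preimage, Metric.mem_ball]
        refine (S_lip B a i (hc i).1 (hd i).1 (hac i) (had i) _ _).trans_lt ?_
        rw [pow_succ]
        nlinarith
  have hM0 : 0 < Real.log r / Real.log a := div_pos_of_neg_of_neg (Real.log_neg hr0 hr1) (Real.log_neg ha0 ha1)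
  refine ⟨(a / R) ^ (Real.log r / Real.log a), Real.log r / Real.log a, by positivity, hM0, ?_⟩
  intro δ hδ
  obtain ⟨n, hn1, hn2⟩ := exists_nat_pow_near_of_lt_one (x := δ / R) (div_pos hδ.1 (by linarith))
    (by rw [div_le_one (by linarith)]; linarith [hδ.2]) ha0 ha1
  filter_upwards [step (n+1)] with x hx
  refine le_trans (le_trans (ENNReal.ofReal_le_ofReal ?_) hx) (measure_mono (Metric.ball_subset_ball ?_))
  · rw [← Real.mul_rpow (by positivity) hδ.1.le]
    have : r = a ^ (Real.log r / Real.log a) := by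
      rw [Real.rpow_def_of_pos ha0, mul_div_cancel₀ _ (Real.log_neg ha0 ha1).ne, Real.exp_log hr0]
    have h3 : r ^ (n+1) = (a ^ (n+1)) ^ (Real.log r / Real.log a) := by
      conv_lhs => rw [this]
      rw [← Real.rpow_natCast, ← Real.rpow_mul ha0.le, mul_comm, Real.rpow_mul ha0.le, Real.rpow_natCast]
    rw [h3]
    apply Real.rpow_le_rpow (by have := hδ.1; positivity) _ hM0.le
    rw [pow_succ', div_mul_eq_mul_div, mul_div_assoc]
    gcongr
  · rw [lt_div_iff₀ (by linarith)] at hn1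
    linarith

lemma massBd_map {c M : ℝ} {μ : Measure (ℝ × ℝ)} [IsProbabilityMeasure μ] (h : MassBd μ c M)
    (π : ℝ × ℝ → ℝ) (hπ : Measurable π) (hl : ∀ x y, dist (π x) (π y) ≤ dist x y) :
    MassBd (Measure.map π μ) c M := by
  intro δ hδ
  have := Measure.isProbabilityMeasure_map (μ := μ) hπ.aemeasurable
  rw [ae_map_iff hπ.aemeasurable (measurableSet_le measurable_const (meas_ball _ δ))]
  filter_upwards [h δ hδ] with x hx
  rw [Measure.map_apply hπ measurableSet_ball]
  refine hx.trans (measure_mono ?_)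
  intro z hz
  exact (hl _ _).trans_lt hz

lemma ennrpow_anti {x y : ENNReal} {z : ℝ} (hz : z ≤ 0) (h : x ≤ y) : y ^ z ≤ x ^ z := by
  have e : ∀ w : ENNReal, w ^ z = (w ^ (-z))⁻¹ := fun w => by rw [← ENNReal.rpow_neg, neg_neg]
  rw [e, e]
  exact ENNReal.inv_le_inv.2 (ENNReal.rpow_le_rpow h (by linarith))

lemma J_upper_cells (ν : Measure ℝ) [IsProbabilityMeasure ν] (q : ℝ) (hq0 : 0 < q) (hq1 : q < 1) (ρ : ℝ)
    (Q : ℤ → Set ℝ) (hQm : ∀ k, MeasurableSet (Q k)) (hQd : Pairwise (Function.onFun Disjoint Q))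
    (hQu : ⋃ k, Q k = univ) (hQ : ∀ k, ∀ x ∈ Q k, Q k ⊆ Metric.ball x ρ) :
    Jq ν q ρ ≤ ∑' k, ν (Q k) ^ q := by
  unfold Jq
  rw [← setLIntegral_univ, ← hQu, lintegral_iUnion hQm hQd]
  refine ENNReal.tsum_le_tsum fun k => ?_
  by_cases h0 : ν (Q k) = 0
  · rw [Measure.restrict_eq_zero.2 h0]; simp
  calc ∫⁻ x in Q k, ν (Metric.ball x ρ) ^ (q - 1) ∂ν
      ≤ ∫⁻ x in Q k, ν (Q k) ^ (q - 1) ∂ν := by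
        refine setLIntegral_mono' (hQm k) fun x hx => ?_
        exact ennrpow_anti (by linarith) (measure_mono (hQ k x hx))
    _ = ν (Q k) ^ q := by
        rw [setLIntegral_const]
        nth_rw 2 [← ENNReal.rpow_one (ν (Q k))]
        rw [← ENNReal.rpow_add _ _ h0 (measure_ne_top _ _)]
        congr 1; ring

/-- Half open cells of side `δ`. -/
def cell (δ : ℝ) (k : ℤ) : Set ℝ := {x | ⌊x / δ⌋ = k}

lemma cell_meas (δ : ℝ) (k : ℤ) : MeasurableSet (cell δ k) := by
  have : Measurable fun x : ℝ => ⌊x / δ⌋ := Int.measurable_floor.comp (measurable_id.div_const δ)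
  exact this (measurableSet_singleton k)

lemma mem_cell {δ : ℝ} (hδ : 0 < δ) {k : ℤ} {x : ℝ} : x ∈ cell δ k ↔ k * δ ≤ x ∧ x < (k + 1) * δ := by
  change ⌊x / δ⌋ = k ↔ _
  rw [Int.floor_eq_iff, le_div_iff₀ hδ, div_lt_iff₀ hδ]

lemma cell_disj (δ : ℝ) : Pairwise (Function.onFun Disjoint (cell δ)) := by
  intro i j hij
  refine Set.disjoint_left.2 fun x hx hy => hij ?_
  exact (show ⌊x / δ⌋ = i from hx).symm.trans hy

lemma cell_union (δ : ℝ) : ⋃ k, cell δ k = univ := by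
  refine Set.eq_univ_of_forall fun x => Set.mem_iUnion.2 ⟨⌊x / δ⌋, rfl⟩

lemma pointwise_cell (m n a : ENNReal) (q : ℝ) (hq0 : 0 < q) (hq1 : q < 1) (hmn : m ≤ n)
    (hm : m ≠ ⊤) (hn : n ≠ ⊤) (ha : a ≠ ⊤) :
    m ^ q ≤ a ^ (q - 1) * (m * n ^ (q - 1)) + a ^ q * n ^ q := by
  by_cases h0 : m = 0
  · simp [h0, hq0]
  rcases le_total (a * n) m with h | h
  · refine le_trans ?_ le_self_add
    calc m ^ q = m * m ^ (q - 1) := by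
          nth_rw 2 [← ENNReal.rpow_one m]
          rw [← ENNReal.rpow_add _ _ h0 hm]; congr 1; ring
      _ ≤ m * (a * n) ^ (q - 1) := by
          gcongr m * ?_
          exact ennrpow_anti (by linarith) h
      _ = _ := by rw [ENNReal.mul_rpow_of_ne_top ha hn]; ring
  · refine le_trans ?_ le_add_self
    rw [← ENNReal.mul_rpow_of_ne_top ha hn]
    exact ENNReal.rpow_le_rpow h hq0.le

lemma J_lower_cells (q : ℝ) (hq0 : 0 < q) (hq1 : q < 1) : ∃ C : ENNReal, C ≠ ⊤ ∧
    ∀ (ν : Measure ℝ) [IsProbabilityMeasure ν], (∃ R : ℝ, ν (Set.Icc (-R) R)ᶜ = 0) →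
    ∀ δ : ℝ, 0 < δ → ∑' k, ν (cell δ k) ^ q ≤ C * Jq ν q δ := by
  set a : ENNReal := (1 / 6 : ENNReal) ^ (1 / q) with ha
  have haT : a ≠ ⊤ := ENNReal.rpow_ne_top_of_nonneg (by positivity) (by norm_num)
  have h60 : (1 / 6 : ENNReal) ≠ 0 := by norm_num
  have ha0 : a ≠ 0 := (ENNReal.rpow_pos (pos_iff_ne_zero.2 h60) (by norm_num)).ne'
  have haq : a ^ q = 1 / 6 := by
    rw [ha, ← ENNReal.rpow_mul, one_div_mul_cancel hq0.ne', ENNReal.rpow_one]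
  refine ⟨2 * a ^ (q - 1), ENNReal.mul_ne_top (by norm_num) (ENNReal.rpow_ne_top_of_ne_zero ha0 haT), ?_⟩
  intro ν _ ⟨R, hR⟩ δ hδ
  set m : ℤ → ENNReal := fun k => ν (cell δ k) with hm
  set X := ∑' k, m k ^ q with hX
  have hXT : X ≠ ⊤ := by
    have hz : ∀ k ∉ Finset.Icc ⌊-R / δ⌋ ⌊R / δ⌋, m k ^ q = 0 := by
      intro k hk
      have : m k = 0 := by
        refine measure_mono_null ?_ hR
        intro x hx hxR
        apply hk
        rw [← (show ⌊x / δ⌋ = k from hx), Finset.mem_Icc]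
        exact ⟨Int.floor_le_floor (by gcongr; exact hxR.1), Int.floor_le_floor (by gcongr; exact hxR.2)⟩
      rw [this, ENNReal.zero_rpow_of_pos hq0]
    rw [hX, tsum_eq_sum hz]
    exact ENNReal.sum_ne_top.2 fun k _ => ENNReal.rpow_ne_top_of_nonneg hq0.le (measure_ne_top _ _)
  set n : ℤ → ENNReal := fun k => m (k - 1) + m k + m (k + 1) with hn
  have hnT : ∀ k, n k ≠ ⊤ := fun k => by
    simp only [hn, hm]
    finiteness
  have hJ : ∑' k, m k * n k ^ (q - 1) ≤ Jq ν q δ := by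
    unfold Jq
    rw [← setLIntegral_univ, ← cell_union δ, lintegral_iUnion (cell_meas δ) (cell_disj δ)]
    refine ENNReal.tsum_le_tsum fun k => ?_
    rw [mul_comm, ← setLIntegral_const]
    refine setLIntegral_mono' (cell_meas δ k) fun x hx => ?_
    apply ennrpow_anti (by linarith)
    have hsub : Metric.ball x δ ⊆ cell δ (k-1) ∪ cell δ k ∪ cell δ (k+1) := by
      intro y hy
      rw [Metric.mem_ball, Real.dist_eq, abs_lt] at hy
      simp only [Set.mem_union, mem_cell hδ] at *
      push_cast
      by_cases h1 : y < k * δ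
      · left; left; constructor <;> linarith [hx.1]
      · by_cases h2 : y < (k + 1) * δ
        · left; right; constructor <;> linarith
        · right; constructor <;> linarith [hx.2]
    refine (measure_mono hsub).trans ((measure_union_le _ _).trans ?_)
    exact add_le_add_left (measure_union_le _ _) _
  have h3 : ∑' k, n k ^ q ≤ 3 * X := by
    calc ∑' k, n k ^ q ≤ ∑' k, (m (k - 1) ^ q + m k ^ q + m (k + 1) ^ q) := by
          refine ENNReal.tsum_le_tsum fun k => ?_
          refine (ENNReal.rpow_add_le_add_rpow _ _ hq0.le hq1.le).trans ?_
          exact add_le_add_left (ENNReal.rpow_add_le_add_rpow _ _ hq0.le hq1.le) _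
      _ = 3 * X := by
          rw [ENNReal.tsum_add, ENNReal.tsum_add]
          have e1 : ∑' k, m (k - 1) ^ q = X := (Equiv.subRight (1 : ℤ)).tsum_eq (fun k => m k ^ q)
          have e2 : ∑' k, m (k + 1) ^ q = X := (Equiv.addRight (1 : ℤ)).tsum_eq (fun k => m k ^ q)
          rw [e1, e2]; ring
  have h4 : X ≤ a ^ (q - 1) * Jq ν q δ + X / 2 := by
    calc X ≤ ∑' k, (a ^ (q - 1) * (m k * n k ^ (q - 1)) + a ^ q * n k ^ q) := by
          refine ENNReal.tsum_le_tsum fun k => ?_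
          refine pointwise_cell _ _ _ _ hq0 hq1 ?_ (measure_ne_top _ _) (hnT k) haT
          simp only [hn]
          exact le_add_right le_add_self
      _ = a ^ (q - 1) * ∑' k, (m k * n k ^ (q - 1)) + a ^ q * ∑' k, n k ^ q := by
          rw [ENNReal.tsum_add, ENNReal.tsum_mul_left, ENNReal.tsum_mul_left]
      _ ≤ a ^ (q - 1) * Jq ν q δ + (1 / 6) * (3 * X) := by
          rw [haq]; gcongr
      _ = _ := by
          congr 1
          rw [← mul_assoc, ENNReal.div_eq_inv_mul (a := X)]
          congr 1
          rw [show (6 : ENNReal) = 2 * 3 by norm_num, one_div, ENNReal.mul_inv (by norm_num) (by norm_num), mul_assoc,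
            ENNReal.inv_mul_cancel (by norm_num) (by norm_num), mul_one]
  have h5 : X / 2 + X / 2 ≤ a ^ (q - 1) * Jq ν q δ + X / 2 := by rwa [ENNReal.add_halves]
  have h6 : X / 2 ≤ a ^ (q - 1) * Jq ν q δ :=
    (ENNReal.add_le_add_iff_right (ENNReal.div_ne_top hXT (by norm_num))).1 h5
  rw [ENNReal.div_le_iff (by norm_num) (by norm_num)] at h6
  calc X ≤ _ := h6
    _ = _ := by ring

lemma J_compare (q : ℝ) (hq0 : 0 < q) (c p t e : ℝ) (hc : 0 < c) (hp : 0 < p) (he : |e| = 1)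
    (ν1 ν2 : Measure ℝ) [IsProbabilityMeasure ν1] [IsProbabilityMeasure ν2]
    (hR : ∃ R : ℝ, ν1 (Set.Icc (-R) R)ᶜ = 0)
    (h : ∀ s, MeasurableSet s → ENNReal.ofReal p * ν2 ((fun x => e * (c * x) + t) ⁻¹' s) ≤ ν1 s) :
    ∃ C : ENNReal, C ≠ ⊤ ∧ ∀ δ : ℝ, 0 < δ → Jq ν2 q (δ / c) ≤ C * Jq ν1 q δ := by
  set f : ℝ → ℝ := fun x => e * (c * x) + t with hf
  have hfm : Measurable f := by fun_prop
  have hp0 : ENNReal.ofReal p ≠ 0 := by simpa using hp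
  have hpT : ENNReal.ofReal p ≠ ⊤ := ENNReal.ofReal_ne_top
  have hdist : ∀ x y, |f x - f y| = c * |x - y| := by
    intro x y
    have : f x - f y = e * (c * (x - y)) := by simp only [hf]; ring
    rw [this, abs_mul, he, one_mul, abs_mul, abs_of_pos hc]
  have hpi : ∀ s, MeasurableSet s → ν2 (f ⁻¹' s) ≤ (ENNReal.ofReal p)⁻¹ * ν1 s := by
    intro s hs
    rw [← ENNReal.mul_le_iff_le_inv hp0 hpT]
    exact h s hs
  rcases lt_or_ge q 1 with hq1 | hq1
  · obtain ⟨C, hC, hC2⟩ := J_lower_cells q hq0 hq1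
    refine ⟨(ENNReal.ofReal p)⁻¹ ^ q * C, ENNReal.mul_ne_top (ENNReal.rpow_ne_top_of_nonneg hq0.le (by simpa using hp)) hC, ?_⟩
    intro δ hδ
    calc Jq ν2 q (δ / c) ≤ ∑' k, ν2 (f ⁻¹' (cell δ k)) ^ q := by
          apply J_upper_cells ν2 q hq0 hq1
          · exact fun k => hfm (cell_meas δ k)
          · exact fun i j hij => (cell_disj δ hij).preimage f
          · rw [← Set.preimage_iUnion, cell_union, Set.preimage_univ]
          · intro k x hx y hy
            rw [Set.mem_preimage, mem_cell hδ] at hx hy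
            rw [Metric.mem_ball, Real.dist_eq, lt_div_iff₀ hc, mul_comm, ← hdist, abs_lt]
            constructor <;> linarith [hx.1, hx.2, hy.1, hy.2]
      _ ≤ ∑' k, (ENNReal.ofReal p)⁻¹ ^ q * ν1 (cell δ k) ^ q := by
          refine ENNReal.tsum_le_tsum fun k => ?_
          rw [← ENNReal.mul_rpow_of_nonneg _ _ hq0.le]
          exact ENNReal.rpow_le_rpow (hpi _ (cell_meas δ k)) hq0.le
      _ ≤ (ENNReal.ofReal p)⁻¹ ^ q * C * Jq ν1 q δ := by
          rw [ENNReal.tsum_mul_left, mul_assoc]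
          gcongr
          exact hC2 ν1 hR δ hδ
  · have hmle : Measure.map f ν2 ≤ (ENNReal.ofReal p)⁻¹ • ν1 := by
      refine Measure.le_iff.2 fun s hs => ?_
      rw [Measure.map_apply hfm hs]
      exact hpi s hs
    refine ⟨(ENNReal.ofReal p)⁻¹ ^ (q - 1) * (ENNReal.ofReal p)⁻¹,
      ENNReal.mul_ne_top (ENNReal.rpow_ne_top_of_nonneg (by linarith) (by simpa using hp)) (by simpa using hp), ?_⟩
    intro δ hδ
    calc Jq ν2 q (δ / c) ≤ ∫⁻ x, (ENNReal.ofReal p)⁻¹ ^ (q - 1) * ν1 (Metric.ball (f x) δ) ^ (q - 1) ∂ν2 := by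
          refine lintegral_mono fun x => ?_
          simp only
          rw [← ENNReal.mul_rpow_of_nonneg _ _ (by linarith)]
          refine ENNReal.rpow_le_rpow (le_trans (measure_mono ?_) (hpi _ measurableSet_ball)) (by linarith)
          intro y hy
          rw [Metric.mem_ball, Real.dist_eq, lt_div_iff₀ hc, mul_comm, ← hdist] at hy
          exact hy
      _ = (ENNReal.ofReal p)⁻¹ ^ (q - 1) * ∫⁻ y, ν1 (Metric.ball y δ) ^ (q - 1) ∂(Measure.map f ν2) := by
          have hm := (meas_ball ν1 δ).pow_const (q - 1)
          rw [lintegral_map hm hfm, lintegral_const_mul]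
          exact hm.comp hfm
      _ ≤ (ENNReal.ofReal p)⁻¹ ^ (q - 1) * ∫⁻ y, ν1 (Metric.ball y δ) ^ (q - 1) ∂((ENNReal.ofReal p)⁻¹ • ν1) := by
          gcongr
      _ = _ := by rw [lintegral_smul_measure, smul_eq_mul, mul_assoc]; rfl

lemma J_bounds {c M : ℝ} (hc : 0 < c) (ν : Measure ℝ) [IsProbabilityMeasure ν]
    (hm : MassBd ν c M) (q : ℝ) {δ : ℝ} (hδ : δ ∈ Set.Ioc (0 : ℝ) 1) :
    ENNReal.ofReal (Real.exp (-(|q - 1| * |Real.log (c * δ ^ M)|))) ≤ Jq ν q δ ∧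
    Jq ν q δ ≤ ENNReal.ofReal (Real.exp (|q - 1| * |Real.log (c * δ ^ M)|)) := by
  have hb : 0 < c * δ ^ M := mul_pos hc (Real.rpow_pos_of_pos hδ.1 _)
  set b := c * δ ^ M with hbdef
  have key : ∀ᵐ x ∂ν, ENNReal.ofReal (Real.exp (-(|q - 1| * |Real.log b|))) ≤ ν (Metric.ball x δ) ^ (q - 1) ∧
      ν (Metric.ball x δ) ^ (q - 1) ≤ ENNReal.ofReal (Real.exp (|q - 1| * |Real.log b|)) := by
    filter_upwards [hm δ hδ] with x hx
    have hT : ν (Metric.ball x δ) ≠ ⊤ := measure_ne_top _ _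
    have h1 : ν (Metric.ball x δ) ≤ 1 := prob_le_one
    set v := (ν (Metric.ball x δ)).toReal with hv
    have hbv : b ≤ v := (ENNReal.ofReal_le_iff_le_toReal hT).1 hx
    have hv0 : 0 < v := hb.trans_le hbv
    have hv1 : v ≤ 1 := by
      have := ENNReal.toReal_mono (by simp) h1
      simpa using this
    have e : ν (Metric.ball x δ) ^ (q - 1) = ENNReal.ofReal (Real.exp (Real.log v * (q - 1))) := by
      rw [← Real.rpow_def_of_pos hv0, ← ENNReal.ofReal_rpow_of_pos hv0, hv, ENNReal.ofReal_toReal hT]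
    have hl : |Real.log v * (q - 1)| ≤ |q - 1| * |Real.log b| := by
      rw [abs_mul, mul_comm]
      gcongr ?_ * ?_
      have a1 : Real.log v ≤ 0 := Real.log_nonpos hv0.le hv1
      have a2 := Real.log_le_log hb hbv
      rw [abs_of_nonpos a1, abs_of_nonpos (a2.trans a1)]; linarith
    rw [abs_le] at hl
    rw [e]
    exact ⟨ENNReal.ofReal_le_ofReal (Real.exp_le_exp.2 hl.1), ENNReal.ofReal_le_ofReal (Real.exp_le_exp.2 hl.2)⟩
  constructor
  · calc _ = ∫⁻ _, ENNReal.ofReal (Real.exp (-(|q - 1| * |Real.log b|))) ∂ν := by simp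
      _ ≤ _ := lintegral_mono_ae (key.mono fun x hx => hx.1)
  · calc Jq ν q δ ≤ ∫⁻ _, ENNReal.ofReal (Real.exp (|q - 1| * |Real.log b|)) ∂ν :=
          lintegral_mono_ae (key.mono fun x hx => hx.2)
      _ = _ := by simp

lemma J_ne_top {c M : ℝ} (hc : 0 < c) (ν : Measure ℝ) [IsProbabilityMeasure ν]
    (hm : MassBd ν c M) (q : ℝ) {δ : ℝ} (hδ : δ ∈ Set.Ioc (0 : ℝ) 1) : Jq ν q δ ≠ ⊤ :=
  ne_top_of_le_ne_top ENNReal.ofReal_ne_top (J_bounds hc ν hm q hδ).2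

lemma J_pos {c M : ℝ} (hc : 0 < c) (ν : Measure ℝ) [IsProbabilityMeasure ν]
    (hm : MassBd ν c M) (q : ℝ) {δ : ℝ} (hδ : δ ∈ Set.Ioc (0 : ℝ) 1) : 0 < (Jq ν q δ).toReal := by
  have := (ENNReal.ofReal_le_iff_le_toReal (J_ne_top hc ν hm q hδ)).1 (J_bounds hc ν hm q hδ).1
  exact (Real.exp_pos _).trans_le this

lemma ev_Ioo {e : ℝ} (he : 0 < e) : ∀ᶠ δ : ℝ in nhdsWithin 0 (Set.Ioi 0), δ ∈ Set.Ioo 0 e :=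
  Ioo_mem_nhdsGT he

lemma spec_tendsto {c M : ℝ} (hc : 0 < c) (hM : 0 < M) (ν : Measure ℝ) [IsProbabilityMeasure ν]
    (hm : MassBd ν c M) (q t : ℝ) (h : IsLqSpec ν q t) :
    Tendsto (fun δ : ℝ => Real.log (Jq ν q δ).toReal / (-Real.log δ)) (nhdsWithin 0 (Set.Ioi 0)) (nhds t) := by
  set u : ℝ → ℝ := fun δ =>
      Real.log (∫ x, (ν (Metric.ball x δ)).toReal ^ (q - 1) ∂ν) / (-Real.log δ) with hu
  have hueq : ∀ δ ∈ Set.Ioo (0 : ℝ) (Real.exp (-1)), u δ = Real.log (Jq ν q δ).toReal / (-Real.log δ) ∧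
      |u δ| ≤ |q - 1| * (|Real.log c| + M) := by
    intro δ hδ
    have hδ1 : δ ∈ Set.Ioc (0 : ℝ) 1 :=
      ⟨hδ.1, hδ.2.le.trans (by rw [Real.exp_le_one_iff]; norm_num)⟩
    have e : ∫ x, (ν (Metric.ball x δ)).toReal ^ (q - 1) ∂ν = (Jq ν q δ).toReal := by
      unfold Jq
      rw [← integral_toReal]
      · simp only [ENNReal.toReal_rpow]
      · exact ((meas_ball ν δ).pow_const _).aemeasurable
      · exact ae_lt_top ((meas_ball ν δ).pow_const _) (J_ne_top hc ν hm q hδ1)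
    have e1 : u δ = Real.log (Jq ν q δ).toReal / (-Real.log δ) := by simp only [hu]; rw [e]
    refine ⟨e1, ?_⟩
    rw [e1]
    have hlog : 1 ≤ -Real.log δ := by
      have := Real.log_le_log hδ.1 hδ.2.le
      rw [Real.log_exp] at this; linarith
    obtain ⟨b1, b2⟩ := J_bounds hc ν hm q hδ1
    have hJ := J_pos hc ν hm q hδ1
    have b1' := (ENNReal.ofReal_le_iff_le_toReal (J_ne_top hc ν hm q hδ1)).1 b1
    have b2' := ENNReal.toReal_le_of_le_ofReal (Real.exp_pos _).le b2
    rw [← Real.le_log_iff_exp_le hJ] at b1'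
    rw [← Real.log_le_iff_le_exp hJ] at b2'
    have b3 : |Real.log (Jq ν q δ).toReal| ≤ |q - 1| * |Real.log (c * δ ^ M)| := abs_le.2 ⟨b1', b2'⟩
    rw [abs_div, abs_of_pos (show 0 < -Real.log δ by linarith), div_le_iff₀ (by linarith)]
    refine b3.trans ?_
    rw [mul_assoc]
    gcongr
    rw [Real.log_mul hc.ne' (Real.rpow_pos_of_pos hδ.1 _).ne', Real.log_rpow hδ.1]
    refine (abs_add_le _ _).trans ?_
    rw [abs_mul, abs_of_pos hM, abs_of_nonpos (show Real.log δ ≤ 0 by linarith)]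
    nlinarith [abs_nonneg (Real.log c)]
  have hev := ev_Ioo (Real.exp_pos (-1))
  have ht : Tendsto u (nhdsWithin 0 (Set.Ioi 0)) (nhds t) := by
    refine tendsto_of_liminf_eq_limsup h.1 h.2 ?_ ?_
    · exact isBoundedUnder_of_eventually_le (hev.mono fun δ hδ => (abs_le.1 (hueq δ hδ).2).2)
    · exact isBoundedUnder_of_eventually_ge (hev.mono fun δ hδ => (abs_le.1 (hueq δ hδ).2).1)
  exact ht.congr' (hev.mono fun δ hδ => (hueq δ hδ).1)

lemma tendsto_const_div_log (K : ℝ) :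
    Tendsto (fun δ : ℝ => K / (-Real.log δ)) (nhdsWithin 0 (Set.Ioi 0)) (nhds 0) := by
  apply Tendsto.const_div_atTop
  exact tendsto_neg_atBot_atTop.comp Real.tendsto_log_nhdsGT_zero

lemma tau_le {c M : ℝ} (hc : 0 < c) (hM : 0 < M) (ν1 ν2 : Measure ℝ) [IsProbabilityMeasure ν1]
    [IsProbabilityMeasure ν2] (hm1 : MassBd ν1 c M) (hm2 : MassBd ν2 c M) (q t1 t2 : ℝ)
    (h1 : IsLqSpec ν1 q t1) (h2 : IsLqSpec ν2 q t2) (r : ℝ) (hr : 0 < r) (C : ENNReal) (hC : C ≠ ⊤)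
    (h : ∀ δ : ℝ, 0 < δ → Jq ν2 q (δ / r) ≤ C * Jq ν1 q δ) : t2 ≤ t1 := by
  have T1 := spec_tendsto hc hM ν1 hm1 q t1 h1
  have T2 := spec_tendsto hc hM ν2 hm2 q t2 h2
  have hmul : Tendsto (fun δ : ℝ => δ * r) (nhdsWithin 0 (Set.Ioi 0)) (nhdsWithin 0 (Set.Ioi 0)) := by
    refine tendsto_nhdsWithin_iff.2 ⟨?_, ?_⟩
    · have : Tendsto (fun δ : ℝ => δ * r) (nhds 0) (nhds (0 * r)) := tendsto_id.mul_const r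
      rw [zero_mul] at this
      exact this.mono_left nhdsWithin_le_nhds
    · filter_upwards [self_mem_nhdsWithin] with δ hδ
      exact mul_pos hδ hr
  have T1' := T1.comp hmul
  have hratio : Tendsto (fun δ : ℝ => 1 + Real.log r / Real.log δ) (nhdsWithin 0 (Set.Ioi 0)) (nhds 1) := by
    have := (tendsto_const_div_log (-Real.log r)).const_add 1
    simpa using this
  have T3 := ((tendsto_const_div_log (Real.log C.toReal)).add (T1'.mul hratio))
  rw [mul_one, zero_add] at T3
  refine le_of_tendsto_of_tendsto T2 T3 ?_
  filter_upwards [ev_Ioo (show (0:ℝ) < 1 by norm_num), ev_Ioo (show (0:ℝ) < 1 / r by positivity)] with δ hδ hδ2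
  have hδr : δ * r < 1 := by rw [← lt_div_iff₀ hr]; exact hδ2.2
  have i1 : δ ∈ Set.Ioc (0 : ℝ) 1 := ⟨hδ.1, hδ.2.le⟩
  have i2 : δ * r ∈ Set.Ioc (0 : ℝ) 1 := ⟨mul_pos hδ.1 hr, hδr.le⟩
  have p2 := J_pos hc ν2 hm2 q i1
  have p1 := J_pos hc ν1 hm1 q i2
  have hh := h (δ * r) (mul_pos hδ.1 hr)
  rw [mul_div_cancel_right₀ _ hr.ne'] at hh
  have hh2 := ENNReal.toReal_mono (ENNReal.mul_ne_top hC (J_ne_top hc ν1 hm1 q i2)) hh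
  rw [ENNReal.toReal_mul] at hh2
  have hCpos : 0 < C.toReal := pos_of_mul_pos_left (p2.trans_le hh2) p1.le
  have hlog := Real.log_le_log p2 hh2
  rw [Real.log_mul hCpos.ne' p1.ne'] at hlog
  have hl0 : Real.log δ < 0 := Real.log_neg hδ.1 hδ.2
  have hl1 : Real.log (δ * r) < 0 := Real.log_neg i2.1 hδr
  simp only [Function.comp]
  have : Real.log (Jq ν1 q (δ * r)).toReal / -Real.log (δ * r) * (1 + Real.log r / Real.log δ) =
      Real.log (Jq ν1 q (δ * r)).toReal / -Real.log δ := by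
    have e : 1 + Real.log r / Real.log δ = Real.log (δ * r) / Real.log δ := by
      rw [Real.log_mul hδ.1.ne' hr.ne', add_div, div_self hl0.ne]
    rw [e]
    have hl1' := hl1.ne
    have hl0' := hl0.ne
    generalize Real.log (δ * r) = A at *
    generalize Real.log δ = A' at *
    field_simp
  rw [this, ← add_div]
  exact div_le_div_of_nonneg_right hlog (by linarith)

lemma tau_zero {c M : ℝ} (hc : 0 < c) (hM : 0 < M) (ν : Measure ℝ) [IsProbabilityMeasure ν]
    (hm : MassBd ν c M) (q t0 t : ℝ) (hq0 : 0 < q) (hq1 : q < 1)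
    (h0 : IsLqSpec ν 0 t0) (h : IsLqSpec ν q t) : t ≤ t0 ∧ t0 ≤ t + M * q := by
  have T0 := spec_tendsto hc hM ν hm 0 t0 h0
  have T := spec_tendsto hc hM ν hm q t h
  have ev := ev_Ioo (show (0:ℝ) < 1 by norm_num)
  constructor
  · refine le_of_tendsto_of_tendsto T T0 ?_
    filter_upwards [ev] with δ hδ
    have i1 : δ ∈ Set.Ioc (0 : ℝ) 1 := ⟨hδ.1, hδ.2.le⟩
    have hl0 : Real.log δ < 0 := Real.log_neg hδ.1 hδ.2
    refine div_le_div_of_nonneg_right (Real.log_le_log (J_pos hc ν hm q i1) ?_) (by linarith)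
    refine ENNReal.toReal_mono (J_ne_top hc ν hm 0 i1) (lintegral_mono fun x => ?_)
    exact ENNReal.rpow_le_rpow_of_exponent_ge prob_le_one (by linarith)
  · have T2 := (T.add (tendsto_const_div_log (-(q * Real.log c)))).add_const (M * q)
    rw [add_zero] at T2
    refine le_of_tendsto_of_tendsto T0 T2 ?_
    filter_upwards [ev] with δ hδ
    have i1 : δ ∈ Set.Ioc (0 : ℝ) 1 := ⟨hδ.1, hδ.2.le⟩
    have hl0 : Real.log δ < 0 := Real.log_neg hδ.1 hδ.2
    have hb : 0 < c * δ ^ M := mul_pos hc (Real.rpow_pos_of_pos hδ.1 _)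
    have hle : ENNReal.ofReal (c * δ ^ M) ^ q * Jq ν 0 δ ≤ Jq ν q δ := by
      unfold Jq
      rw [← lintegral_const_mul _ ((meas_ball ν δ).pow_const _)]
      refine lintegral_mono_ae ?_
      filter_upwards [hm δ i1] with x hx
      have hx0 : ν (Metric.ball x δ) ≠ 0 := by
        have : 0 < ENNReal.ofReal (c * δ ^ M) := ENNReal.ofReal_pos.2 hb
        exact (this.trans_le hx).ne'
      have e : ν (Metric.ball x δ) ^ (q - 1) = ν (Metric.ball x δ) ^ q * ν (Metric.ball x δ) ^ (0 - 1 : ℝ) := by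
        rw [← ENNReal.rpow_add _ _ hx0 (measure_ne_top _ _)]; congr 1; ring
      rw [e]
      gcongr
    have p0 := J_pos hc ν hm 0 i1
    have h2 := ENNReal.toReal_mono (J_ne_top hc ν hm q i1) hle
    rw [ENNReal.toReal_mul, ← ENNReal.toReal_rpow, ENNReal.toReal_ofReal hb.le] at h2
    have h3 := Real.log_le_log (by positivity) h2
    rw [Real.log_mul (by positivity) p0.ne', Real.log_rpow hb, Real.log_mul hc.ne' (Real.rpow_pos_of_pos hδ.1 _).ne',
      Real.log_rpow hδ.1] at h3
    rw [← add_div, div_add' _ _ _ (by linarith)]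
    refine div_le_div_of_nonneg_right ?_ (by linarith)
    linarith

lemma tau_eq {ι : Type} [Fintype ι] [Nonempty ι] (B : IFSData ι)
    (hc : ∀ i, B.c i ∈ Set.Ioo (0 : ℝ) 1) (hd : ∀ i, B.d i ∈ Set.Ioo (0 : ℝ) 1)
    (p : ι → ℝ) (hp : ∀ i, p i ∈ Set.Ioo (0 : ℝ) 1)
    (μ : Measure (ℝ × ℝ)) [IsProbabilityMeasure μ]
    (hcpt : ∃ K : Set (ℝ × ℝ), IsCompact K ∧ μ Kᶜ = 0)
    (hself : μ = ∑ i : ι, ENNReal.ofReal (p i) • Measure.map (B.S i) μ)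
    (τ1 τ2 : ℝ → ℝ)
    (hτ1 : ∀ q : ℝ, 0 ≤ q → IsLqSpec (Measure.map Prod.fst μ) q (τ1 q))
    (hτ2 : ∀ q : ℝ, 0 ≤ q → IsLqSpec (Measure.map Prod.snd μ) q (τ2 q))
    (i : ι) (hi : B.swap i = true) (q : ℝ) (hq : 0 ≤ q) : τ1 q = τ2 q := by
  obtain ⟨c, M, hc0, hM, hmass⟩ := mass_mu B hc hd p hp μ hcpt hself
  have hm1 := massBd_map hmass Prod.fst measurable_fst (fun x y => by rw [Prod.dist_eq]; exact le_max_left _ _)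
  have hm2 := massBd_map hmass Prod.snd measurable_snd (fun x y => by rw [Prod.dist_eq]; exact le_max_right _ _)
  have P1 := Measure.isProbabilityMeasure_map (μ := μ) measurable_fst.aemeasurable
  have P2 := Measure.isProbabilityMeasure_map (μ := μ) measurable_snd.aemeasurable
  have hpμ : ∀ (s : Set (ℝ × ℝ)), MeasurableSet s →
      ENNReal.ofReal (p i) * μ (B.S i ⁻¹' s) ≤ μ s := by
    intro s hs
    conv_rhs => rw [hself]
    rw [Measure.finsetSum_apply]
    refine le_trans ?_ (Finset.single_le_sum
      (f := fun i => (ENNReal.ofReal (p i) • Measure.map (B.S i) μ) s) (fun _ _ => zero_le) (Finset.mem_univ i))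
    simp [Measure.map_apply (S_meas B i) hs]
  obtain ⟨K, hK, hK0⟩ := hcpt
  obtain ⟨R, hR⟩ := hK.isBounded.subset_ball (0 : ℝ × ℝ)
  have hR1 : Measure.map Prod.fst μ (Set.Icc (-R) R)ᶜ = 0 := by
    rw [Measure.map_apply measurable_fst measurableSet_Icc.compl]
    refine measure_mono_null ?_ hK0
    intro x hx hxK
    apply hx
    have := hR hxK
    rw [mem_ball_zero_iff, Prod.norm_def, max_lt_iff, Real.norm_eq_abs, abs_lt] at this
    exact ⟨this.1.1.le, this.1.2.le⟩
  have hR2 : Measure.map Prod.snd μ (Set.Icc (-R) R)ᶜ = 0 := by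
    rw [Measure.map_apply measurable_snd measurableSet_Icc.compl]
    refine measure_mono_null ?_ hK0
    intro x hx hxK
    apply hx
    have := hR hxK
    rw [mem_ball_zero_iff, Prod.norm_def, max_lt_iff, Real.norm_eq_abs, Real.norm_eq_abs, abs_lt, abs_lt] at this
    exact ⟨this.2.1.le, this.2.2.le⟩
  have he : ∀ b : Bool, |(if b then (1 : ℝ) else -1)| = 1 := by intro b; cases b <;> simp
  have pos : ∀ q : ℝ, 0 < q → τ1 q = τ2 q := by
    intro q hq
    apply le_antisymm
    · obtain ⟨C, hC, hJ⟩ := J_compare q hq (B.d i) (p i) (B.t i).2 (if B.sgn2 i then 1 else -1) (hd i).1 (hp i).1 (he _)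
        (Measure.map Prod.snd μ) (Measure.map Prod.fst μ) ⟨R, hR2⟩ (by
          intro s hs
          rw [Measure.map_apply measurable_snd hs, Measure.map_apply measurable_fst
            ((show Measurable (fun x : ℝ => (if B.sgn2 i then (1:ℝ) else -1) * (B.d i * x) + (B.t i).2) by fun_prop) hs)]
          refine le_trans (le_of_eq ?_) (hpμ _ (measurable_snd hs))
          congr 2
          ext x
          simp [IFSData.S, hi])
      exact tau_le hc0 hM _ _ hm2 hm1 q _ _ (hτ2 q hq.le) (hτ1 q hq.le) (B.d i) (hd i).1 C hC hJ
    · obtain ⟨C, hC, hJ⟩ := J_compare q hq (B.c i) (p i) (B.t i).1 (if B.sgn1 i then 1 else -1) (hc i).1 (hp i).1 (he _)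
        (Measure.map Prod.fst μ) (Measure.map Prod.snd μ) ⟨R, hR1⟩ (by
          intro s hs
          rw [Measure.map_apply measurable_fst hs, Measure.map_apply measurable_snd
            ((show Measurable (fun x : ℝ => (if B.sgn1 i then (1:ℝ) else -1) * (B.c i * x) + (B.t i).1) by fun_prop) hs)]
          refine le_trans (le_of_eq ?_) (hpμ _ (measurable_fst hs))
          congr 2
          ext x
          simp [IFSData.S, hi])
      exact tau_le hc0 hM _ _ hm1 hm2 q _ _ (hτ1 q hq.le) (hτ2 q hq.le) (B.c i) (hc i).1 C hC hJ
  rcases hq.eq_or_lt with rfl | hq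
  · have hh : ∀ ε ∈ Set.Ioo (0 : ℝ) 1, |τ1 0 - τ2 0| ≤ M * ε := by
      intro ε hε
      obtain ⟨a1, a2⟩ := tau_zero hc0 hM _ hm1 ε _ _ hε.1 hε.2 (hτ1 0 le_rfl) (hτ1 ε hε.1.le)
      obtain ⟨b1, b2⟩ := tau_zero hc0 hM _ hm2 ε _ _ hε.1 hε.2 (hτ2 0 le_rfl) (hτ2 ε hε.1.le)
      have := pos ε hε.1
      rw [abs_le]; constructor <;> linarith
    by_contra hne
    have hpos : 0 < |τ1 0 - τ2 0| := abs_pos.2 (sub_ne_zero.2 hne)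
    set D := |τ1 0 - τ2 0|
    have hε : 0 < min (1/2) (D / (2 * M)) := by positivity
    have h1 := hh _ ⟨hε, (min_le_left _ _).trans_lt (by norm_num)⟩
    have h2 : M * min (1/2) (D / (2 * M)) ≤ M * (D / (2 * M)) := by
      gcongr; exact min_le_right _ _
    have h3 : M * (D / (2 * M)) = D / 2 := by field_simp
    linarith
  · exact pos q hq

section words
variable {ι : Type}

/-- First branch of the modified singular value function. -/
def G1 (s T1 : ℝ) (w : ℝ × ℝ) : ℝ := w.1 ^ T1 * w.2 ^ (s - T1)

/-- Second branch of the modified singular value function. -/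
def G2 (s T2 : ℝ) (w : ℝ × ℝ) : ℝ := w.2 ^ T2 * w.1 ^ (s - T2)

lemma dims_cons (B : IFSData ι) (i : ι) (l : List ι) : B.dims (i :: l) =
    (B.c i * (if B.swap i then (B.dims l).2 else (B.dims l).1),
      B.d i * (if B.swap i then (B.dims l).1 else (B.dims l).2)) := rfl

lemma swapW_cons (B : IFSData ι) (i : ι) (l : List ι) : B.swapW (i :: l) = xor (B.swap i) (B.swapW l) := rfl

lemma dims_append (B : IFSData ι) (u v : List ι) : B.dims (u ++ v) =
    if B.swapW u then ((B.dims u).1 * (B.dims v).2, (B.dims u).2 * (B.dims v).1)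
    else ((B.dims u).1 * (B.dims v).1, (B.dims u).2 * (B.dims v).2) := by
  induction u with
  | nil => simp [IFSData.dims, IFSData.swapW]
  | cons i u ih =>
    rw [List.cons_append, dims_cons, dims_cons, swapW_cons, ih]
    cases B.swap i <;> cases B.swapW u <;> simp [mul_assoc]

lemma dims_bounds (B : IFSData ι) (a : ℝ) (hc : ∀ i, B.c i ∈ Set.Ioo (0 : ℝ) 1)
    (hd : ∀ i, B.d i ∈ Set.Ioo (0 : ℝ) 1) (hca : ∀ i, B.c i ≤ a) (hda : ∀ i, B.d i ≤ a) (l : List ι) :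
    0 < (B.dims l).1 ∧ 0 < (B.dims l).2 ∧ (B.dims l).1 ≤ a ^ l.length ∧ (B.dims l).2 ≤ a ^ l.length := by
  induction l with
  | nil => simp [IFSData.dims]
  | cons i l ih =>
    obtain ⟨h1, h2, h3, h4⟩ := ih
    have ha : 0 < a := (hc i).1.trans_le (hca i)
    have hci := (hc i).1
    have hdi := (hd i).1
    rw [dims_cons, List.length_cons, pow_succ']
    cases B.swap i <;> simp only [if_true, if_false, Bool.false_eq_true] <;>
    refine ⟨by positivity, by positivity, ?_, ?_⟩ <;> gcongr <;> first | exact hca i | exact hda i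

lemma alpha2_pos (B : IFSData ι) (hc : ∀ i, B.c i ∈ Set.Ioo (0 : ℝ) 1)
    (hd : ∀ i, B.d i ∈ Set.Ioo (0 : ℝ) 1) (l : List ι) : 0 < B.alpha2 l := by
  obtain ⟨h1, h2, -⟩ := dims_bounds B 1 hc hd (fun i => (hc i).2.le) (fun i => (hd i).2.le) l
  exact lt_min h1 h2

lemma alpha2_le (B : IFSData ι) (a : ℝ) (hc : ∀ i, B.c i ∈ Set.Ioo (0 : ℝ) 1)
    (hd : ∀ i, B.d i ∈ Set.Ioo (0 : ℝ) 1) (hca : ∀ i, B.c i ≤ a) (hda : ∀ i, B.d i ≤ a) (l : List ι) :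
    B.alpha2 l ≤ a ^ l.length :=
  (min_le_left _ _).trans (dims_bounds B a hc hd hca hda l).2.2.1

lemma wordProb_pos (p : ι → ℝ) (hp : ∀ i, p i ∈ Set.Ioo (0 : ℝ) 1) (l : List ι) : 0 < wordProb p l := by
  induction l with
  | nil => simp [wordProb]
  | cons i l ih => simp only [wordProb, List.map_cons, List.prod_cons] at *; exact mul_pos (hp i).1 ih

lemma wordProb_append (p : ι → ℝ) (u v : List ι) : wordProb p (u ++ v) = wordProb p u * wordProb p v := by
  simp [wordProb]

lemma psi_pos (B : IFSData ι) (hc : ∀ i, B.c i ∈ Set.Ioo (0 : ℝ) 1)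
    (hd : ∀ i, B.d i ∈ Set.Ioo (0 : ℝ) 1) (p : ι → ℝ) (hp : ∀ i, p i ∈ Set.Ioo (0 : ℝ) 1)
    (τ1 τ2 : ℝ → ℝ) (s q : ℝ) (l : List ι) : 0 < psiSV B p τ1 τ2 s q l := by
  have h2 := alpha2_pos B hc hd l
  have h1 : 0 < B.alpha1 l := h2.trans_le (min_le_max)
  have h3 := wordProb_pos p hp l
  unfold psiSV
  positivity

lemma G_ratio {b h s T1 T2 : ℝ} (hb : 0 < b) (hh : 0 < h) :
    G1 s T1 (b, h) = G2 s T2 (b, h) * (b / h) ^ (T1 + T2 - s) := by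
  unfold G1 G2
  simp only
  have e1 : b ^ T1 = b ^ (s - T2) * b ^ (T1 + T2 - s) := by
    rw [← Real.rpow_add hb]; congr 1; ring
  have e2 : h ^ T2 = h ^ (s - T1) * h ^ (T1 + T2 - s) := by
    rw [← Real.rpow_add hh]; congr 1; ring
  rw [Real.div_rpow hb.le hh.le, e1, e2]
  have h3 := (Real.rpow_pos_of_pos hh (T1 + T2 - s)).ne'
  generalize h ^ (T1 + T2 - s) = z at *
  field_simp

lemma G1_pos {s T : ℝ} {w : ℝ × ℝ} (h1 : 0 < w.1) (h2 : 0 < w.2) : 0 < G1 s T w := by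
  unfold G1; positivity

lemma G2_pos {s T : ℝ} {w : ℝ × ℝ} (h1 : 0 < w.1) (h2 : 0 < w.2) : 0 < G2 s T w := by
  unfold G2; positivity

lemma G_order {s T1 T2 : ℝ} {w : ℝ × ℝ} (h1 : 0 < w.1) (h2 : 0 < w.2) :
    (s ≤ T1 + T2 → w.2 ≤ w.1 → G2 s T2 w ≤ G1 s T1 w) ∧
    (s ≤ T1 + T2 → w.1 ≤ w.2 → G1 s T1 w ≤ G2 s T2 w) ∧
    (T1 + T2 ≤ s → w.2 ≤ w.1 → G1 s T1 w ≤ G2 s T2 w) ∧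
    (T1 + T2 ≤ s → w.1 ≤ w.2 → G2 s T2 w ≤ G1 s T1 w) := by
  obtain ⟨b, h⟩ := w
  simp only at h1 h2 ⊢
  have hg : 0 < G2 s T2 (b, h) := G2_pos h1 h2
  rw [G_ratio (T2 := T2) h1 h2]
  have hpos : 0 < b / h := div_pos h1 h2
  refine ⟨fun hs hw => ?_, fun hs hw => ?_, fun hs hw => ?_, fun hs hw => ?_⟩
  · exact le_mul_of_one_le_right hg.le (Real.one_le_rpow ((one_le_div h2).2 hw) (by linarith))
  · exact mul_le_of_le_one_right hg.le (Real.rpow_le_one hpos.le ((div_le_one h2).2 hw) (by linarith))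
  · exact mul_le_of_le_one_right hg.le
      (Real.rpow_le_one_of_one_le_of_nonpos ((one_le_div h2).2 hw) (by linarith))
  · exact le_mul_of_one_le_right hg.le
      (Real.one_le_rpow_of_pos_of_le_one_of_nonpos hpos ((div_le_one h2).2 hw) (by linarith))

lemma swapW_false (B : IFSData ι) (h : ∀ i, B.swap i = false) (l : List ι) : B.swapW l = false := by
  induction l with
  | nil => rfl
  | cons i l ih => rw [swapW_cons, h, ih]; rfl

lemma psi_eq_G (B : IFSData ι) (p : ι → ℝ) (τ1 τ2 : ℝ → ℝ) (s q : ℝ)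
    (H : (∀ i, B.swap i = false) ∨ τ1 q = τ2 q) (l : List ι) :
    ((B.dims l).2 ≤ (B.dims l).1 → psiSV B p τ1 τ2 s q l = wordProb p l ^ q * G1 s (τ1 q) (B.dims l)) ∧
    ((B.dims l).1 < (B.dims l).2 → psiSV B p τ1 τ2 s q l = wordProb p l ^ q * G2 s (τ2 q) (B.dims l)) := by
  constructor
  · intro h
    have ht : tauW B τ1 τ2 l q = τ1 q := by
      unfold tauW
      rcases H with H | H
      · rw [if_pos]; left; exact ⟨swapW_false B H l, h⟩
      · rw [H, ite_self]
    unfold psiSV G1 IFSData.alpha1 IFSData.alpha2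
    rw [ht, max_eq_left h, min_eq_right h, mul_assoc]
  · intro h
    have ht : tauW B τ1 τ2 l q = τ2 q := by
      unfold tauW
      rcases H with H | H
      · rw [if_neg]
        rintro (h' | h')
        · exact absurd h'.2 (not_le.2 h)
        · rw [swapW_false B H l] at h'; simp at h'
      · rw [H, ite_self]
    unfold psiSV G2 IFSData.alpha1 IFSData.alpha2
    rw [ht, max_eq_right h.le, min_eq_left h.le, mul_assoc]

lemma psi_max (B : IFSData ι) (hc : ∀ i, B.c i ∈ Set.Ioo (0 : ℝ) 1)
    (hd : ∀ i, B.d i ∈ Set.Ioo (0 : ℝ) 1) (p : ι → ℝ) (τ1 τ2 : ℝ → ℝ) (s q : ℝ)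
    (H : (∀ i, B.swap i = false) ∨ τ1 q = τ2 q) (hs : s ≤ τ1 q + τ2 q) (l : List ι) :
    psiSV B p τ1 τ2 s q l = wordProb p l ^ q * max (G1 s (τ1 q) (B.dims l)) (G2 s (τ2 q) (B.dims l)) := by
  obtain ⟨h1, h2, -⟩ := dims_bounds B 1 hc hd (fun i => (hc i).2.le) (fun i => (hd i).2.le) l
  obtain ⟨e1, e2⟩ := psi_eq_G B p τ1 τ2 s q H l
  obtain ⟨o1, o2, -⟩ := G_order (s := s) (T1 := τ1 q) (T2 := τ2 q) h1 h2
  rcases le_or_gt (B.dims l).2 (B.dims l).1 with h | h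
  · rw [e1 h, max_eq_left (o1 hs h)]
  · rw [e2 h, max_eq_right (o2 hs h.le)]

lemma psi_min (B : IFSData ι) (hc : ∀ i, B.c i ∈ Set.Ioo (0 : ℝ) 1)
    (hd : ∀ i, B.d i ∈ Set.Ioo (0 : ℝ) 1) (p : ι → ℝ) (τ1 τ2 : ℝ → ℝ) (s q : ℝ)
    (H : (∀ i, B.swap i = false) ∨ τ1 q = τ2 q) (hs : τ1 q + τ2 q ≤ s) (l : List ι) :
    psiSV B p τ1 τ2 s q l = wordProb p l ^ q * min (G1 s (τ1 q) (B.dims l)) (G2 s (τ2 q) (B.dims l)) := by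
  obtain ⟨h1, h2, -⟩ := dims_bounds B 1 hc hd (fun i => (hc i).2.le) (fun i => (hd i).2.le) l
  obtain ⟨e1, e2⟩ := psi_eq_G B p τ1 τ2 s q H l
  obtain ⟨-, -, o1, o2⟩ := G_order (s := s) (T1 := τ1 q) (T2 := τ2 q) h1 h2
  rcases le_or_gt (B.dims l).2 (B.dims l).1 with h | h
  · rw [e1 h, min_eq_left (o1 hs h)]
  · rw [e2 h, min_eq_right (o2 hs h.le)]

lemma G_append (B : IFSData ι) (hc : ∀ i, B.c i ∈ Set.Ioo (0 : ℝ) 1)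
    (hd : ∀ i, B.d i ∈ Set.Ioo (0 : ℝ) 1) (s T1 T2 : ℝ)
    (H : (∀ i, B.swap i = false) ∨ T1 = T2) (u v : List ι) :
    ∃ x y, G1 s T1 (B.dims (u ++ v)) = G1 s T1 (B.dims u) * x ∧
      G2 s T2 (B.dims (u ++ v)) = G2 s T2 (B.dims u) * y ∧
      ((x = G1 s T1 (B.dims v) ∧ y = G2 s T2 (B.dims v)) ∨
       (y = G1 s T1 (B.dims v) ∧ x = G2 s T2 (B.dims v))) := by
  obtain ⟨h1, h2, -⟩ := dims_bounds B 1 hc hd (fun i => (hc i).2.le) (fun i => (hd i).2.le) u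
  obtain ⟨h3, h4, -⟩ := dims_bounds B 1 hc hd (fun i => (hc i).2.le) (fun i => (hd i).2.le) v
  rw [dims_append]
  by_cases hsw : B.swapW u = true
  · have HT : T1 = T2 := by
      rcases H with H | H
      · rw [swapW_false B H u] at hsw; simp at hsw
      · exact H
    subst HT
    refine ⟨G2 s T1 (B.dims v), G1 s T1 (B.dims v), ?_, ?_, Or.inr ⟨rfl, rfl⟩⟩
    · rw [if_pos hsw]; unfold G1 G2; simp only
      rw [Real.mul_rpow h1.le h4.le, Real.mul_rpow h2.le h3.le]; ring
    · rw [if_pos hsw]; unfold G1 G2; simp only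
      rw [Real.mul_rpow h1.le h4.le, Real.mul_rpow h2.le h3.le]; ring
  · refine ⟨G1 s T1 (B.dims v), G2 s T2 (B.dims v), ?_, ?_, Or.inl ⟨rfl, rfl⟩⟩
    · rw [if_neg hsw]; unfold G1; simp only
      rw [Real.mul_rpow h1.le h3.le, Real.mul_rpow h2.le h4.le]; ring
    · rw [if_neg hsw]; unfold G2; simp only
      rw [Real.mul_rpow h1.le h3.le, Real.mul_rpow h2.le h4.le]; ring

lemma psi_sub (B : IFSData ι) (hc : ∀ i, B.c i ∈ Set.Ioo (0 : ℝ) 1)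
    (hd : ∀ i, B.d i ∈ Set.Ioo (0 : ℝ) 1) (p : ι → ℝ) (hp : ∀ i, p i ∈ Set.Ioo (0 : ℝ) 1)
    (τ1 τ2 : ℝ → ℝ) (s q : ℝ)
    (H : (∀ i, B.swap i = false) ∨ τ1 q = τ2 q) (hs : s ≤ τ1 q + τ2 q) (u v : List ι) :
    psiSV B p τ1 τ2 s q (u ++ v) ≤ psiSV B p τ1 τ2 s q u * psiSV B p τ1 τ2 s q v := by
  obtain ⟨h1, h2, -⟩ := dims_bounds B 1 hc hd (fun i => (hc i).2.le) (fun i => (hd i).2.le) u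
  obtain ⟨h3, h4, -⟩ := dims_bounds B 1 hc hd (fun i => (hc i).2.le) (fun i => (hd i).2.le) v
  rw [psi_max B hc hd p τ1 τ2 s q H hs, psi_max B hc hd p τ1 τ2 s q H hs, psi_max B hc hd p τ1 τ2 s q H hs,
    wordProb_append, Real.mul_rpow (wordProb_pos p hp u).le (wordProb_pos p hp v).le]
  obtain ⟨x, y, e1, e2, e3⟩ := G_append B hc hd s _ _ H u v
  rw [e1, e2, mul_mul_mul_comm]
  have hu := wordProb_pos p hp u
  have hv := wordProb_pos p hp v
  refine mul_le_mul_of_nonneg_left ?_ (by positivity)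
  have g1 : 0 < G1 s (τ1 q) (B.dims u) := G1_pos h1 h2
  have g2 : 0 < G1 s (τ1 q) (B.dims v) := G1_pos h3 h4
  have g3 : 0 < G2 s (τ2 q) (B.dims u) := G2_pos h1 h2
  have g4 : 0 < G2 s (τ2 q) (B.dims v) := G2_pos h3 h4
  refine max_le ?_ ?_
  · refine mul_le_mul (le_max_left _ _) ?_ ?_ ?_ <;> rcases e3 with ⟨rfl, rfl⟩ | ⟨rfl, rfl⟩ <;>
      first | positivity | simp
  · refine mul_le_mul (le_max_right _ _) ?_ ?_ ?_ <;> rcases e3 with ⟨rfl, rfl⟩ | ⟨rfl, rfl⟩ <;>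
      first | positivity | simp

lemma psi_super (B : IFSData ι) (hc : ∀ i, B.c i ∈ Set.Ioo (0 : ℝ) 1)
    (hd : ∀ i, B.d i ∈ Set.Ioo (0 : ℝ) 1) (p : ι → ℝ) (hp : ∀ i, p i ∈ Set.Ioo (0 : ℝ) 1)
    (τ1 τ2 : ℝ → ℝ) (s q : ℝ)
    (H : (∀ i, B.swap i = false) ∨ τ1 q = τ2 q) (hs : τ1 q + τ2 q ≤ s) (u v : List ι) :
    psiSV B p τ1 τ2 s q u * psiSV B p τ1 τ2 s q v ≤ psiSV B p τ1 τ2 s q (u ++ v) ∧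
    psiSV B p τ1 τ2 s q (u ++ v) ≤ psiSV B p τ1 τ2 s q u *
      (wordProb p v ^ q * (G1 s (τ1 q) (B.dims v) + G2 s (τ2 q) (B.dims v))) := by
  obtain ⟨h1, h2, -⟩ := dims_bounds B 1 hc hd (fun i => (hc i).2.le) (fun i => (hd i).2.le) u
  obtain ⟨h3, h4, -⟩ := dims_bounds B 1 hc hd (fun i => (hc i).2.le) (fun i => (hd i).2.le) v
  rw [psi_min B hc hd p τ1 τ2 s q H hs, psi_min B hc hd p τ1 τ2 s q H hs, psi_min B hc hd p τ1 τ2 s q H hs,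
    wordProb_append, Real.mul_rpow (wordProb_pos p hp u).le (wordProb_pos p hp v).le]
  obtain ⟨x, y, e1, e2, e3⟩ := G_append B hc hd s _ _ H u v
  rw [e1, e2]
  have hu := wordProb_pos p hp u
  have hv := wordProb_pos p hp v
  have g1 : 0 < G1 s (τ1 q) (B.dims u) := G1_pos h1 h2
  have g2 : 0 < G1 s (τ1 q) (B.dims v) := G1_pos h3 h4
  have g3 : 0 < G2 s (τ2 q) (B.dims u) := G2_pos h1 h2
  have g4 : 0 < G2 s (τ2 q) (B.dims v) := G2_pos h3 h4
  have hxy : 0 < x ∧ 0 < y ∧ min (G1 s (τ1 q) (B.dims v)) (G2 s (τ2 q) (B.dims v)) = min x y ∧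
      G1 s (τ1 q) (B.dims v) + G2 s (τ2 q) (B.dims v) = x + y := by
    rcases e3 with ⟨rfl, rfl⟩ | ⟨rfl, rfl⟩
    · exact ⟨g2, g4, rfl, rfl⟩
    · exact ⟨g4, g2, min_comm _ _, add_comm _ _⟩
  obtain ⟨hx, hy, e4, e5⟩ := hxy
  rw [e4, e5]
  constructor
  · rw [mul_mul_mul_comm]
    refine mul_le_mul_of_nonneg_left ?_ (by positivity)
    refine le_min ?_ ?_
    · exact mul_le_mul (min_le_left _ _) (min_le_left _ _) (le_min hx.le hy.le) g1.le
    · exact mul_le_mul (min_le_right _ _) (min_le_right _ _) (le_min hx.le hy.le) g3.le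
  · rw [mul_mul_mul_comm]
    refine mul_le_mul_of_nonneg_left ?_ (by positivity)
    rcases le_total (G1 s (τ1 q) (B.dims u)) (G2 s (τ2 q) (B.dims u)) with h | h
    · rw [min_eq_left h]
      exact (min_le_left _ _).trans (mul_le_mul_of_nonneg_left (by linarith) g1.le)
    · rw [min_eq_right h]
      exact (min_le_right _ _).trans (mul_le_mul_of_nonneg_left (by linarith) g3.le)

/-- Sum over words of length `n`. -/
def Wsum [Fintype ι] (n : ℕ) (f : List ι → ℝ) : ℝ := ∑ v : Fin n → ι, f (List.ofFn v)

lemma Wsum_zero [Fintype ι] (f : List ι → ℝ) : Wsum 0 f = f [] := by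
  simp [Wsum]

lemma Wsum_succ_left [Fintype ι] (n : ℕ) (f : List ι → ℝ) :
    Wsum (n + 1) f = ∑ i, Wsum n (fun v => f (i :: v)) := by
  unfold Wsum
  rw [← (Fin.consEquiv (fun _ => ι)).sum_comp, Fintype.sum_prod_type]
  simp [Fin.consEquiv, List.ofFn_succ]

lemma Wsum_succ_right [Fintype ι] (n : ℕ) (f : List ι → ℝ) :
    Wsum (n + 1) f = Wsum n (fun v => ∑ i, f (v ++ [i])) := by
  unfold Wsum
  rw [← (Fin.snocEquiv (fun _ => ι)).sum_comp, Fintype.sum_prod_type_right]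
  refine Finset.sum_congr rfl fun x _ => Finset.sum_congr rfl fun i _ => ?_
  rw [List.ofFn_succ', List.concat_eq_append]
  simp [Fin.snocEquiv]

lemma Wsum_mono [Fintype ι] (n : ℕ) {f g : List ι → ℝ} (h : ∀ l, l.length = n → f l ≤ g l) :
    Wsum n f ≤ Wsum n g := Finset.sum_le_sum fun v _ => h _ (by simp)

lemma Wsum_mul [Fintype ι] (n : ℕ) (c : ℝ) (f : List ι → ℝ) :
    Wsum n (fun v => c * f v) = c * Wsum n f := by
  unfold Wsum; rw [Finset.mul_sum]

lemma Wsum_nonneg [Fintype ι] (n : ℕ) {f : List ι → ℝ} (h : ∀ l, 0 ≤ f l) : 0 ≤ Wsum n f :=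
  Finset.sum_nonneg fun v _ => h _

lemma Wsum_add [Fintype ι] (n : ℕ) (f g : List ι → ℝ) :
    Wsum n (fun v => f v + g v) = Wsum n f + Wsum n g := Finset.sum_add_distrib

lemma tsum_list [Fintype ι] (f : List ι → ℝ) (hf : Summable f) :
    ∑' l, f l = ∑' n, Wsum n f ∧ Summable (fun n => Wsum n f) := by
  have h := (List.equivSigmaTuple (α := ι)).symm.summable_iff.2 hf
  rw [← (List.equivSigmaTuple (α := ι)).symm.tsum_eq]
  change (∑' c, (f ∘ List.equivSigmaTuple.symm) c) = _ ∧ _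
  rw [h.tsum_sigma]
  have e : ∀ n, ∑' c : Fin n → ι, (f ∘ List.equivSigmaTuple.symm) ⟨n, c⟩ = Wsum n f := fun n => by
    rw [tsum_fintype]; rfl
  refine ⟨tsum_congr e, ?_⟩
  exact (h.sigma).congr fun n => e n

lemma summable_list [Fintype ι] (f : List ι → ℝ) (h0 : ∀ l, 0 ≤ f l) (hf : Summable (fun n => Wsum n f)) :
    Summable f := by
  rw [← (List.equivSigmaTuple (α := ι)).symm.summable_iff]
  refine (summable_sigma_of_nonneg (f := f ∘ List.equivSigmaTuple.symm) (fun x => h0 _)).2 ⟨fun n => Summable.of_finite, ?_⟩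
  refine hf.congr fun n => ?_
  rw [tsum_fintype]; rfl

lemma stop_finite [Fintype ι] (B : IFSData ι) (a : ℝ) (ha0 : 0 < a) (ha1 : a < 1)
    (hc : ∀ i, B.c i ∈ Set.Ioo (0 : ℝ) 1)
    (hd : ∀ i, B.d i ∈ Set.Ioo (0 : ℝ) 1) (hca : ∀ i, B.c i ≤ a) (hda : ∀ i, B.d i ≤ a)
    (δ : ℝ) (hδ : 0 < δ) : (stopping B δ).Finite := by
  obtain ⟨N, hN⟩ := exists_pow_lt_of_lt_one hδ ha1
  refine (List.finite_length_le ι N).subset ?_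
  intro l hl
  have h1 := hl.2.2.trans (alpha2_le B a hc hd hca hda _)
  have h2 : l.dropLast.length < N := by
    by_contra hlt
    exact absurd (h1.trans (pow_le_pow_of_le_one ha0.le ha1.le (not_lt.1 hlt))) (not_le.2 hN)
  rw [List.length_dropLast] at h2
  simp only [Set.mem_ofPred_eq]
  omega

lemma stop_lower [Fintype ι] (B : IFSData ι) (a : ℝ) (ha0 : 0 < a) (ha1 : a < 1)
    (hc : ∀ i, B.c i ∈ Set.Ioo (0 : ℝ) 1)
    (hd : ∀ i, B.d i ∈ Set.Ioo (0 : ℝ) 1) (hca : ∀ i, B.c i ≤ a) (hda : ∀ i, B.d i ≤ a)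
    (δ : ℝ) (hδ : δ ∈ Set.Ioc (0 : ℝ) 1) (h : List ι → ℝ) (h0 : ∀ l, 0 ≤ h l)
    (hh : ∀ u, δ ≤ B.alpha2 u → h u ≤ ∑ i, h (u ++ [i])) :
    h [] ≤ ∑' l : stopping B δ, h l.1 := by
  obtain ⟨N, hN⟩ := exists_pow_lt_of_lt_one hδ.1 ha1
  have hfin := stop_finite B a ha0 ha1 hc hd hca hda δ hδ.1
  set r : List ι → ℝ := (stopping B δ).indicator h with hr
  have hr0 : ∀ l, 0 ≤ r l := fun l => Set.indicator_nonneg (fun x _ => h0 x) l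
  have hrs : Summable r := summable_of_finite_support (hfin.subset Set.support_indicator_subset)
  set g : List ι → ℝ := fun u => if δ ≤ B.alpha2 u then h u else 0 with hg
  have step : ∀ n, Wsum n g ≤ Wsum (n+1) g + Wsum (n+1) r := by
    intro n
    rw [← Wsum_add, Wsum_succ_right]
    refine Wsum_mono n fun u _ => ?_
    have hnn : ∀ w, 0 ≤ g w + r w := fun w => by
      have := hr0 w; have := h0 w; simp only [hg]; split_ifs <;> linarith
    by_cases hu : δ ≤ B.alpha2 u
    · simp only [hg, if_pos hu]
      refine (hh u hu).trans (Finset.sum_le_sum fun i _ => ?_)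
      by_cases hi : δ ≤ B.alpha2 (u ++ [i])
      · rw [if_pos hi]; linarith [hr0 (u ++ [i])]
      · have hmem : u ++ [i] ∈ stopping B δ := ⟨by simp, not_le.1 hi, by simpa using hu⟩
        rw [if_neg hi, hr, Set.indicator_of_mem hmem, zero_add]
    · have : g u = 0 := by simp only [hg, if_neg hu]
      rw [this]
      exact Finset.sum_nonneg fun i _ => hnn _
  have tel : ∀ n, h [] ≤ ∑ k ∈ Finset.range n, Wsum (k+1) r + Wsum n g := by
    intro n
    induction n with
    | zero =>
      have : δ ≤ B.alpha2 ([] : List ι) := by simpa [IFSData.alpha2, IFSData.dims] using hδ.2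
      simp [Wsum_zero, hg, this]
    | succ n ih =>
      rw [Finset.sum_range_succ]
      linarith [step n]
  have hz : Wsum N g = 0 := by
    unfold Wsum
    refine Finset.sum_eq_zero fun v _ => ?_
    simp only [hg]
    rw [if_neg]
    have := alpha2_le B a hc hd hca hda (List.ofFn v)
    rw [List.length_ofFn] at this
    exact not_le.2 (this.trans_lt hN)
  obtain ⟨e1, e2⟩ := tsum_list r hrs
  rw [tsum_subtype (stopping B δ) h, ← hr, e1]
  have h1 := tel N
  rw [hz, add_zero] at h1
  refine h1.trans ?_
  have h2 : ∑ k ∈ Finset.range N, Wsum (k+1) r ≤ ∑ k ∈ Finset.range (N+1), Wsum k r := by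
    rw [Finset.sum_range_succ']
    linarith [Wsum_nonneg 0 hr0]
  exact h2.trans (e2.sum_le_tsum _ fun k _ => Wsum_nonneg k hr0)

end words

section final
variable {ι : Type} [Fintype ι]

lemma PsiSV_eq_Wsum (B : IFSData ι) (p : ι → ℝ) (τ1 τ2 : ℝ → ℝ) (k : ℕ) (s q : ℝ) :
    PsiSV B p τ1 τ2 k s q = Wsum k (psiSV B p τ1 τ2 s q) := rfl

lemma Psi_shift (B : IFSData ι) (a : ℝ) (ha0 : 0 < a)
    (hc : ∀ i, B.c i ∈ Set.Ioo (0 : ℝ) 1)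
    (hd : ∀ i, B.d i ∈ Set.Ioo (0 : ℝ) 1) (hca : ∀ i, B.c i ≤ a) (hda : ∀ i, B.d i ≤ a)
    (p : ι → ℝ) (hp : ∀ i, p i ∈ Set.Ioo (0 : ℝ) 1)
    (τ1 τ2 : ℝ → ℝ) (s t q : ℝ) (hst : s ≤ t) (k : ℕ) :
    PsiSV B p τ1 τ2 k t q ≤ (a ^ (t - s)) ^ k * PsiSV B p τ1 τ2 k s q := by
  rw [PsiSV_eq_Wsum, PsiSV_eq_Wsum, ← Wsum_mul]
  refine Wsum_mono k fun l hl => ?_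
  have h2 := alpha2_pos B hc hd l
  have h3 := alpha2_le B a hc hd hca hda l
  rw [hl] at h3
  have e : psiSV B p τ1 τ2 t q l = B.alpha2 l ^ (t - s) * psiSV B p τ1 τ2 s q l := by
    unfold psiSV
    rw [show t - tauW B τ1 τ2 l q = (t - s) + (s - tauW B τ1 τ2 l q) by ring, Real.rpow_add h2]
    ring
  rw [e]
  refine mul_le_mul_of_nonneg_right ?_ (psi_pos B hc hd p hp τ1 τ2 s q l).le
  have h4 : (a ^ (t - s)) ^ k = (a ^ k) ^ (t - s) := by
    rw [← Real.rpow_natCast, ← Real.rpow_natCast, ← Real.rpow_mul ha0.le, ← Real.rpow_mul ha0.le, mul_comm]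
  rw [h4]
  exact Real.rpow_le_rpow h2.le h3 (by linarith)

lemma P_shift (x y : ℕ → ℝ) (b X Y : ℝ) (hb : 0 ≤ b) (hx0 : ∀ k, 0 ≤ x k) (hy0 : ∀ k, 0 ≤ y k)
    (h : ∀ k, x k ≤ b ^ k * y k)
    (hX : Tendsto (fun k : ℕ => x k ^ ((k : ℝ)⁻¹)) atTop (nhds X))
    (hY : Tendsto (fun k : ℕ => y k ^ ((k : ℝ)⁻¹)) atTop (nhds Y)) : X ≤ b * Y := by
  refine le_of_tendsto_of_tendsto hX (hY.const_mul b) ?_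
  filter_upwards [eventually_gt_atTop 0] with k hk
  calc x k ^ ((k : ℝ)⁻¹) ≤ (b ^ k * y k) ^ ((k : ℝ)⁻¹) :=
        Real.rpow_le_rpow (hx0 k) (h k) (by positivity)
    _ = b * y k ^ ((k : ℝ)⁻¹) := by
        rw [Real.mul_rpow (by positivity) (hy0 k), Real.pow_rpow_inv_natCast hb hk.ne']

lemma root_pow (x : ℝ) (hx : 0 ≤ x) (k : ℕ) (hk : 0 < k) : (x ^ ((k : ℝ)⁻¹)) ^ k = x :=
  Real.rpow_inv_natCast_pow hx hk.ne'

lemma sub_case (B : IFSData ι) (a : ℝ) (ha0 : 0 < a) (ha1 : a < 1)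
    (hc : ∀ i, B.c i ∈ Set.Ioo (0 : ℝ) 1)
    (hd : ∀ i, B.d i ∈ Set.Ioo (0 : ℝ) 1) (hca : ∀ i, B.c i ≤ a) (hda : ∀ i, B.d i ≤ a)
    (ψ : List ι → ℝ) (hψ : ∀ l, 0 < ψ l) (hsub : ∀ u v, ψ (u ++ v) ≤ ψ u * ψ v)
    (hinf : Tendsto (fun k => Wsum k ψ) atTop atTop) (δ : ℝ) (hδ : δ ∈ Set.Ioc (0 : ℝ) 1) :
    1 ≤ ∑' l : stopping B δ, ψ l.1 := by
  obtain ⟨N0, hN0⟩ := exists_pow_lt_of_lt_one hδ.1 ha1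
  obtain ⟨N, hN, hmax⟩ := Filter.high_scores hinf (max N0 1)
  have hNpos : 0 < Wsum N ψ := (Wsum_nonneg 0 fun l => (hψ l).le).trans_lt (hmax 0 (by
    have := le_max_right N0 1; omega))
  have hmax' : ∀ m, m ≤ N → Wsum m ψ ≤ Wsum N ψ := fun m hm => by
    rcases hm.eq_or_lt with rfl | h
    · exact le_rfl
    · exact (hmax m h).le
  have hfin := stop_finite B a ha0 ha1 hc hd hca hda δ hδ.1
  haveI : Finite (stopping B δ) := hfin
  have key := stop_lower B a ha0 ha1 hc hd hca hda δ hδ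
    (fun u => Wsum (N - u.length) (fun v => ψ (u ++ v))) (fun l => Wsum_nonneg _ fun v => (hψ _).le) (by
      intro u hu
      have hlen : u.length < N := by
        by_contra hlt
        have h1 := hu.trans (alpha2_le B a hc hd hca hda _)
        have h2 : N0 ≤ u.length := (le_max_left N0 1).trans (hN.trans (not_lt.1 hlt))
        exact absurd (h1.trans (pow_le_pow_of_le_one ha0.le ha1.le h2)) (not_le.2 hN0)
      obtain ⟨m, hm⟩ : ∃ m, N - u.length = m + 1 := ⟨N - u.length - 1, by omega⟩
      simp only [hm, Wsum_succ_left]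
      refine le_of_eq (Finset.sum_congr rfl fun i _ => ?_)
      have : N - (u ++ [i]).length = m := by simp; omega
      rw [this]
      simp)
  simp only [List.length_nil, Nat.sub_zero, List.nil_append] at key
  have h2 : ∑' l : stopping B δ, Wsum (N - l.1.length) (fun v => ψ (l.1 ++ v)) ≤
      ∑' l : stopping B δ, ψ l.1 * Wsum N ψ := by
    refine Summable.tsum_le_tsum (fun l => ?_) Summable.of_finite Summable.of_finite
    calc _ ≤ Wsum (N - l.1.length) (fun v => ψ l.1 * ψ v) := Wsum_mono _ fun v _ => hsub _ _
      _ = ψ l.1 * Wsum (N - l.1.length) ψ := Wsum_mul _ _ _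
      _ ≤ _ := mul_le_mul_of_nonneg_left (hmax' _ (Nat.sub_le _ _)) (hψ _).le
  rw [tsum_mul_right] at h2
  have h3 : 1 * Wsum N ψ ≤ (∑' l : stopping B δ, ψ l.1) * Wsum N ψ := by
    rw [one_mul]; exact key.trans h2
  exact le_of_mul_le_mul_right h3 hNpos

lemma super_case (B : IFSData ι) (a : ℝ) (ha0 : 0 < a) (ha1 : a < 1)
    (hc : ∀ i, B.c i ∈ Set.Ioo (0 : ℝ) 1)
    (hd : ∀ i, B.d i ∈ Set.Ioo (0 : ℝ) 1) (hca : ∀ i, B.c i ≤ a) (hda : ∀ i, B.d i ≤ a)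
    (ψ φ : List ι → ℝ) (hψ : ∀ l, 0 < ψ l) (hψ1 : ψ [] = 1) (hsup : ∀ u v, ψ u * ψ v ≤ ψ (u ++ v))
    (hφ0 : ∀ l, 0 ≤ φ l) (hφ : ∀ u v, ψ (u ++ v) ≤ ψ u * φ v)
    (k : ℕ) (hk : 0 < k) (hk1 : 1 ≤ Wsum k ψ) :
    ∃ c0 : ℝ, 0 < c0 ∧ ∀ δ ∈ Set.Ioc (0 : ℝ) 1, c0 ≤ ∑' l : stopping B δ, ψ l.1 := by
  set C := ∑ j ∈ Finset.range k, Wsum j φ with hC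
  have hC0 : 0 ≤ C := Finset.sum_nonneg fun j _ => Wsum_nonneg j hφ0
  refine ⟨1 / (C + 1), by positivity, fun δ hδ => ?_⟩
  have hfin := stop_finite B a ha0 ha1 hc hd hca hda δ hδ.1
  haveI : Finite (stopping B δ) := hfin
  set h : List ι → ℝ := fun u => ∑ j ∈ Finset.range k, Wsum j (fun v => ψ (u ++ v)) with hh
  have key := stop_lower B a ha0 ha1 hc hd hca hda δ hδ h
    (fun l => Finset.sum_nonneg fun j _ => Wsum_nonneg _ fun v => (hψ _).le) (by
      intro u _
      simp only [hh]
      rw [Finset.sum_comm]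
      have e : ∀ j, ∑ i, Wsum j (fun v => ψ (u ++ [i] ++ v)) = Wsum (j+1) (fun v => ψ (u ++ v)) := by
        intro j
        rw [Wsum_succ_left]
        simp
      rw [Finset.sum_congr rfl fun j _ => e j]
      have h1 := Finset.sum_range_succ (fun j => Wsum j (fun v => ψ (u ++ v))) k
      rw [Finset.sum_range_succ'] at h1
      have h2 : ψ u ≤ Wsum k (fun v => ψ (u ++ v)) := by
        calc ψ u = ψ u * 1 := (mul_one _).symm
          _ ≤ ψ u * Wsum k ψ := mul_le_mul_of_nonneg_left hk1 (hψ u).le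
          _ = Wsum k (fun v => ψ u * ψ v) := (Wsum_mul _ _ _).symm
          _ ≤ _ := Wsum_mono _ fun v _ => hsup u v
      have h3 : Wsum 0 (fun v => ψ (u ++ v)) = ψ u := by rw [Wsum_zero]; simp
      linarith)
  have h1 : 1 ≤ h [] := by
    simp only [hh, List.nil_append]
    have := Finset.single_le_sum (f := fun j => Wsum j (fun v => ψ v)) (s := Finset.range k)
      (fun j _ => Wsum_nonneg j fun v => (hψ v).le) (Finset.mem_range.2 hk)
    refine le_trans (le_of_eq ?_) this
    rw [Wsum_zero, hψ1]
  have h2 : ∑' l : stopping B δ, h l.1 ≤ ∑' l : stopping B δ, ψ l.1 * (C + 1) := by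
    refine Summable.tsum_le_tsum (fun l => ?_) Summable.of_finite Summable.of_finite
    have h4 : h l.1 ≤ ψ l.1 * C := by
      simp only [hh, hC]
      rw [Finset.mul_sum]
      refine Finset.sum_le_sum fun j _ => ?_
      rw [← Wsum_mul]
      exact Wsum_mono _ fun v _ => hφ _ _
    linarith [hψ l.1]
  rw [tsum_mul_right] at h2
  rw [div_le_iff₀ (by positivity)]
  linarith

end final


theorem stopping_sums_bounded
    {ι : Type} [Fintype ι] [Nonempty ι] (hcard : 2 ≤ Fintype.card ι)
    (B : IFSData ι)
    (hc : ∀ i, B.c i ∈ Set.Ioo (0 : ℝ) 1) (hd : ∀ i, B.d i ∈ Set.Ioo (0 : ℝ) 1)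
    (p : ι → ℝ) (hp : ∀ i, p i ∈ Set.Ioo (0 : ℝ) 1) (hpsum : ∑ i : ι, p i = 1)
    (μ : Measure (ℝ × ℝ)) [IsProbabilityMeasure μ]
    (hcpt : ∃ K : Set (ℝ × ℝ), IsCompact K ∧ μ Kᶜ = 0)
    (hself : μ = ∑ i : ι, ENNReal.ofReal (p i) • Measure.map (B.S i) μ)
    (τ1 τ2 : ℝ → ℝ)
    (hτ1 : ∀ q : ℝ, 0 ≤ q → IsLqSpec (Measure.map Prod.fst μ) q (τ1 q))
    (hτ2 : ∀ q : ℝ, 0 ≤ q → IsLqSpec (Measure.map Prod.snd μ) q (τ2 q))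
    (P : ℝ → ℝ → ℝ)
    (hP : ∀ s q : ℝ, 0 ≤ q →
      Tendsto (fun k : ℕ => PsiSV B p τ1 τ2 k s q ^ ((k : ℝ)⁻¹)) atTop (nhds (P s q)))
    (γ : ℝ → ℝ) (hγ : ∀ q : ℝ, 0 ≤ q → P (γ q) q = 1)
     :
    ∀ t q : ℝ, 0 ≤ q →
      ((γ q < t → ∃ C : ℝ, ∀ δ ∈ Set.Ioc (0 : ℝ) 1,
          (∑' l : stopping B δ, psiSV B p τ1 τ2 t q l.1) ≤ C) ∧
       (t < γ q → ∃ c0 : ℝ, 0 < c0 ∧ ∀ δ ∈ Set.Ioc (0 : ℝ) 1,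
          c0 ≤ ∑' l : stopping B δ, psiSV B p τ1 τ2 t q l.1)) := by
  intro t q hq
  obtain ⟨i0, hi0⟩ := Finite.exists_max (fun i => max (B.c i) (B.d i))
  set a := max (B.c i0) (B.d i0) with ha
  have ha0 : 0 < a := (hc i0).1.trans_le (le_max_left _ _)
  have ha1 : a < 1 := max_lt (hc i0).2 (hd i0).2
  have hca : ∀ i, B.c i ≤ a := fun i => (le_max_left _ _).trans (hi0 i)
  have hda : ∀ i, B.d i ≤ a := fun i => (le_max_right _ _).trans (hi0 i)
  have hψ := fun s l => psi_pos B hc hd p hp τ1 τ2 s q l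
  have hΨ0 : ∀ s k, 0 ≤ PsiSV B p τ1 τ2 k s q := fun s k => Wsum_nonneg k fun l => (hψ s l).le
  have hshift : ∀ s s', s ≤ s' → P s' q ≤ a ^ (s' - s) * P s q := fun s s' hs =>
    P_shift _ _ _ _ _ (by positivity) (hΨ0 s') (hΨ0 s)
      (Psi_shift B a ha0 hc hd hca hda p hp τ1 τ2 s s' q hs) (hP s' q hq) (hP s q hq)
  constructor
  · intro ht
    have h1 := hshift _ _ ht.le
    rw [hγ q hq, mul_one] at h1
    have h2 : P t q < 1 := h1.trans_lt (Real.rpow_lt_one ha0.le ha1 (by linarith))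
    obtain ⟨ρ, hρ1, hρ2⟩ := exists_between h2
    have hP0 : 0 ≤ P t q := ge_of_tendsto' (hP t q hq) fun k => Real.rpow_nonneg (hΨ0 t k) _
    have hev : ∀ᶠ k : ℕ in atTop, ‖PsiSV B p τ1 τ2 k t q‖ ≤ ρ ^ k := by
      filter_upwards [(hP t q hq).eventually_lt_const hρ1, eventually_gt_atTop 0] with k hk hk0
      rw [Real.norm_of_nonneg (hΨ0 t k), ← root_pow _ (hΨ0 t k) k hk0]
      exact pow_le_pow_left₀ (Real.rpow_nonneg (hΨ0 t k) _) hk.le k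
    have hsum : Summable (fun k => PsiSV B p τ1 τ2 k t q) :=
      Summable.of_norm_bounded_eventually_nat (summable_geometric_of_lt_one (hP0.trans hρ1.le) hρ2) hev
    have hs := summable_list (psiSV B p τ1 τ2 t q) (fun l => (hψ t l).le) hsum
    exact ⟨∑' l, psiSV B p τ1 τ2 t q l, fun δ _ =>
      Summable.tsum_subtype_le _ (stopping B δ) (fun l => (hψ t l).le) hs⟩
  · intro ht
    have h1 := hshift _ _ ht.le
    rw [hγ q hq] at h1
    have h3 : a ^ (γ q - t) < 1 := Real.rpow_lt_one ha0.le ha1 (by linarith)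
    have h4 : 0 < a ^ (γ q - t) := by positivity
    have h2 : 1 < P t q := by
      by_contra hle
      have := mul_le_mul_of_nonneg_left (not_lt.1 hle) h4.le
      linarith
    obtain ⟨ρ, hρ1, hρ2⟩ := exists_between h2
    have hev : ∀ᶠ k : ℕ in atTop, ρ ^ k ≤ PsiSV B p τ1 τ2 k t q := by
      filter_upwards [(hP t q hq).eventually_const_lt hρ2, eventually_gt_atTop 0] with k hk hk0
      rw [← root_pow _ (hΨ0 t k) k hk0]
      exact pow_le_pow_left₀ (by linarith) hk.le k
    have hinf : Tendsto (fun k => Wsum k (psiSV B p τ1 τ2 t q)) atTop atTop :=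
      tendsto_atTop_mono' _ hev (tendsto_pow_atTop_atTop_of_one_lt hρ1)
    have H : (∀ i, B.swap i = false) ∨ τ1 q = τ2 q := by
      by_cases h : ∃ i, B.swap i = true
      · obtain ⟨i, hi⟩ := h
        exact Or.inr (tau_eq B hc hd p hp μ hcpt hself τ1 τ2 hτ1 hτ2 i hi q hq)
      · left
        intro i
        by_contra hi
        exact h ⟨i, by simpa using hi⟩
    rcases le_total t (τ1 q + τ2 q) with hs | hs
    · exact ⟨1, one_pos, sub_case B a ha0 ha1 hc hd hca hda _ (hψ t)
        (psi_sub B hc hd p hp τ1 τ2 t q H hs) hinf⟩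
    · obtain ⟨k, hk1, hk0⟩ := ((hinf.eventually_ge_atTop 1).and (eventually_gt_atTop 0)).exists
      refine super_case B a ha0 ha1 hc hd hca hda (psiSV B p τ1 τ2 t q)
        (fun v => wordProb p v ^ q * (G1 t (τ1 q) (B.dims v) + G2 t (τ2 q) (B.dims v))) (hψ t) ?_
        (fun u v => (psi_super B hc hd p hp τ1 τ2 t q H hs u v).1) (fun v => ?_)
        (fun u v => (psi_super B hc hd p hp τ1 τ2 t q H hs u v).2) k hk0 hk1
      · simp [psiSV, wordProb, IFSData.alpha1, IFSData.alpha2, IFSData.dims]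
      · obtain ⟨g1, g2, -⟩ := dims_bounds B 1 hc hd (fun i => (hc i).2.le) (fun i => (hd i).2.le) v
        have := wordProb_pos p hp v
        have := G1_pos (s := t) (T := τ1 q) g1 g2
        have := G2_pos (s := t) (T := τ2 q) g1 g2
        positivity
end
end

section
/- For each q ≥ 0 there exist constants 0 < c ≤ C < ∞ such that for all δ ∈ (0,1] and all i ∈ I_δ, c · D_{δ/α_1(i)}^q(p(i)·π_iμ) ≤ D_δ^q(μ_i) ≤ C · D_{δ/α_1(i)}^q(p(i)·π_iμ), where μ_i = p(i) · μ∘S_i^{−1}. -/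
open MeasureTheory Filter Set

attribute [local instance] Classical.propDecidable

noncomputable section

/-- `m^q` with the convention `0^0 = 0`. -/
def mpow (m : ENNReal) (q : ℝ) : ℝ := if m = 0 then 0 else m.toReal ^ q

/-- `D_δ^q(ν)` for the mesh of squares of side `δ` on the plane, anchored at the origin. -/
def meshSum2 (ν : Measure (ℝ × ℝ)) (q δ : ℝ) : ℝ :=
  ∑' k : ℤ × ℤ,
    mpow (ν (Set.Icc ((k.1 : ℝ) * δ) (((k.1 : ℝ) + 1) * δ) ×ˢ
      Set.Icc ((k.2 : ℝ) * δ) (((k.2 : ℝ) + 1) * δ))) q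

/-- `D_δ^q(ν)` for the mesh of intervals of length `δ` on the line, anchored at the origin. -/
def meshSum1 (ν : Measure ℝ) (q δ : ℝ) : ℝ :=
  ∑' k : ℤ, mpow (ν (Set.Icc ((k : ℝ) * δ) (((k : ℝ) + 1) * δ))) q

lemma mpow_nonneg_aux (m : ENNReal) (q : ℝ) : 0 ≤ mpow m q := by
  unfold mpow; split_ifs
  · exact le_rfl
  · positivity

lemma mpow_sum_le_aux {β : Type*} (s : Finset β) (e : β → ENNReal) (he : ∀ j, e j ≠ ⊤)
    (x : ENNReal) (hx : x ≤ ∑ j ∈ s, e j) (q : ℝ) (hq : 0 ≤ q) (L : ℝ) (hs : (s.card : ℝ) ≤ L) :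
    mpow x q ≤ L ^ q * ∑ j ∈ s, mpow (e j) q := by
  have hL : 0 ≤ L := le_trans (Nat.cast_nonneg _) hs
  have hnn : 0 ≤ ∑ j ∈ s, mpow (e j) q := Finset.sum_nonneg fun j _ => mpow_nonneg_aux _ _
  by_cases h0 : x = 0
  · simp only [mpow, h0, if_true]
    have := Real.rpow_nonneg hL q
    exact mul_nonneg this hnn
  have hne : s.Nonempty := by
    by_contra h
    rw [Finset.not_nonempty_iff_eq_empty] at h
    subst h
    simp at hx
    exact h0 hx
  obtain ⟨j, hj, hmax⟩ := s.exists_max_image e hne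
  have h1 : x ≤ s.card * e j := by
    refine hx.trans ?_
    have := Finset.sum_le_card_nsmul s e (e j) hmax
    simpa using this
  have hej : e j ≠ 0 := by
    intro h; rw [h] at h1; simp at h1; exact h0 h1
  have h2 : x.toReal ≤ L * (e j).toReal := by
    have h3 : x.toReal ≤ (s.card * e j).toReal :=
      ENNReal.toReal_mono (ENNReal.mul_ne_top (by simp) (he j)) h1
    rw [ENNReal.toReal_mul, ENNReal.toReal_natCast] at h3
    exact h3.trans (mul_le_mul_of_nonneg_right hs ENNReal.toReal_nonneg)
  have h4 : mpow x q ≤ L ^ q * mpow (e j) q := by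
    simp only [mpow, h0, hej, if_false]
    rw [← Real.mul_rpow hL ENNReal.toReal_nonneg]
    exact Real.rpow_le_rpow ENNReal.toReal_nonneg h2 hq
  refine h4.trans (mul_le_mul_of_nonneg_left ?_ (Real.rpow_nonneg hL q))
  exact Finset.single_le_sum (f := fun j => mpow (e j) q) (fun i _ => mpow_nonneg_aux _ _) hj

lemma tsum_compare_aux {α β : Type*} (a : α → ENNReal) (e : β → ENNReal) (he : ∀ j, e j ≠ ⊤)
    (Rel : α → β → Prop) (J : α → Finset β) (J' : β → Finset α)
    (hJ' : ∀ k j, Rel k j → k ∈ J' j)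
    (ha : ∀ k, a k ≤ ∑ j ∈ (J k).filter (fun j => Rel k j), e j)
    (L : ℝ) (hcJ : ∀ k, ((J k).card : ℝ) ≤ L) (hcJ' : ∀ j, ((J' j).card : ℝ) ≤ L)
    (T : Finset β) (hT : ∀ j, e j ≠ 0 → j ∈ T) (q : ℝ) (hq : 0 ≤ q) :
    (∃ U : Finset α, ∀ k, a k ≠ 0 → k ∈ U) ∧
    ∑' k, mpow (a k) q ≤ (L ^ q * L) * ∑' j, mpow (e j) q := by
  set U : Finset α := T.biUnion J' with hU
  have hUa : ∀ k, a k ≠ 0 → k ∈ U := by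
    intro k hk
    have h1 : ∑ j ∈ (J k).filter (fun j => Rel k j), e j ≠ 0 := by
      intro h; have := ha k; rw [h] at this; simp at this; exact hk this
    obtain ⟨j, hj, hej⟩ := Finset.exists_ne_zero_of_sum_ne_zero h1
    rw [hU, Finset.mem_biUnion]
    exact ⟨j, hT j hej, hJ' k j (Finset.mem_filter.1 hj).2⟩
  refine ⟨⟨U, hUa⟩, ?_⟩
  rw [tsum_eq_sum (s := U) (fun k hk => by
        have : a k = 0 := by by_contra h; exact hk (hUa k h)
        simp [mpow, this]),
      tsum_eq_sum (s := T) (fun k hk => by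
        have : e k = 0 := by by_contra h; exact hk (hT k h)
        simp [mpow, this])]
  have key : ∀ k, mpow (a k) q ≤ L ^ q * ∑ j ∈ T, if Rel k j then mpow (e j) q else 0 := by
    intro k
    have hcc : (((J k).filter (fun j => Rel k j)).card : ℝ) ≤ L :=
      le_trans (by exact_mod_cast Finset.card_filter_le _ _) (hcJ k)
    have hL : 0 ≤ L := le_trans (Nat.cast_nonneg _) hcc
    refine (mpow_sum_le_aux _ e he _ (ha k) q hq L hcc).trans ?_
    refine mul_le_mul_of_nonneg_left ?_ (Real.rpow_nonneg hL q)
    rw [← Finset.sum_filter, ← Finset.sum_filter_ne_zero ((J k).filter (fun j => Rel k j))]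
    refine Finset.sum_le_sum_of_subset_of_nonneg ?_ (fun j _ _ => mpow_nonneg_aux _ _)
    intro j hj
    obtain ⟨hj, hne⟩ := Finset.mem_filter.1 hj
    rw [Finset.mem_filter] at hj ⊢
    refine ⟨hT j ?_, hj.2⟩
    intro h; exact hne (by simp [mpow, h])
  calc ∑ k ∈ U, mpow (a k) q
      ≤ ∑ k ∈ U, L ^ q * ∑ j ∈ T, (if Rel k j then mpow (e j) q else 0) :=
        Finset.sum_le_sum fun k _ => key k
    _ = L ^ q * ∑ j ∈ T, ∑ k ∈ U, (if Rel k j then mpow (e j) q else 0) := by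
        rw [← Finset.mul_sum, Finset.sum_comm]
    _ ≤ L ^ q * ∑ j ∈ T, L * mpow (e j) q := by
        rcases T.eq_empty_or_nonempty with h | ⟨j0, _⟩
        · simp [h]
        have hL : 0 ≤ L := le_trans (Nat.cast_nonneg _) (hcJ' j0)
        refine mul_le_mul_of_nonneg_left ?_ (Real.rpow_nonneg hL q)
        refine Finset.sum_le_sum fun j _ => ?_
        rw [← Finset.sum_filter, Finset.sum_const, nsmul_eq_mul]
        refine mul_le_mul_of_nonneg_right (le_trans ?_ (hcJ' j)) (mpow_nonneg_aux _ _)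
        norm_cast
        refine Finset.card_le_card fun k hk => hJ' k j (Finset.mem_filter.1 hk).2
    _ = (L ^ q * L) * ∑ j ∈ T, mpow (e j) q := by
        rw [← Finset.mul_sum]; ring

/-- integers within distance `R` of a real -/
def nearInts (x R : ℝ) : Finset ℤ := Finset.Icc ⌈x - R⌉ ⌊x + R⌋

lemma mem_nearInts (x R : ℝ) (k : ℤ) : k ∈ nearInts x R ↔ |(k : ℝ) - x| ≤ R := by
  rw [nearInts, Finset.mem_Icc, Int.ceil_le, Int.le_floor, abs_le]
  constructor <;> rintro ⟨h1, h2⟩ <;> constructor <;> linarith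

lemma card_nearInts (x R : ℝ) (hR : 0 ≤ R) : ((nearInts x R).card : ℝ) ≤ 2 * R + 1 := by
  rw [nearInts, Int.card_Icc]
  have h1 := Int.floor_le (x + R)
  have h2 := Int.le_ceil (x - R)
  rcases le_total 0 (⌊x + R⌋ + 1 - ⌈x - R⌉) with h | h
  · have : (((⌊x + R⌋ + 1 - ⌈x - R⌉).toNat : ℤ) : ℝ) = ((⌊x + R⌋ + 1 - ⌈x - R⌉ : ℤ) : ℝ) := by
      rw [Int.toNat_of_nonneg h]
    rw [Int.cast_natCast] at this
    rw [this]; push_cast; linarith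
  · rw [Int.toNat_of_nonpos h]; push_cast; linarith

lemma core_compare {X : Type*} [MeasurableSpace X] (ν : Measure X) [IsFiniteMeasure ν]
    (K : Set X) (hK : ν Kᶜ = 0) (f : X → ℝ × ℝ) (g : X → ℝ)
    (hf : Measurable f) (hg : Measurable g) (G : ℝ) (hG : ∀ x ∈ K, |g x| ≤ G)
    (δ A ε s s' R : ℝ) (hδ : 0 < δ) (hA : 0 < A) (hε : ε = 1 ∨ ε = -1) (hR : 0 ≤ R)
    (h1 : ∀ x ∈ K, (f x).1 = ε * A * g x + s) (h2 : ∀ x ∈ K, |(f x).2 - s'| ≤ R * δ)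
    (q : ℝ) (hq : 0 ≤ q) (L : ℝ) (hL : L = 5 * (2 * R + 3)) :
    meshSum1 (Measure.map g ν) q (δ / A) ≤ (L ^ q * L) * meshSum2 (Measure.map f ν) q δ ∧
    meshSum2 (Measure.map f ν) q δ ≤ (L ^ q * L) * meshSum1 (Measure.map g ν) q (δ / A) := by
  set r := δ / A with hr
  have hr0 : 0 < r := div_pos hδ hA
  have hrA : r * A = δ := by rw [hr]; field_simp
  set Q : ℤ × ℤ → Set X := fun k => f ⁻¹' (Set.Icc ((k.1 : ℝ) * δ) (((k.1 : ℝ) + 1) * δ) ×ˢ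
      Set.Icc ((k.2 : ℝ) * δ) (((k.2 : ℝ) + 1) * δ)) with hQ
  set E : ℤ → Set X := fun j => g ⁻¹' (Set.Icc ((j : ℝ) * r) (((j : ℝ) + 1) * r)) with hE
  have hm2 : meshSum2 (Measure.map f ν) q δ = ∑' k, mpow (ν (Q k)) q := by
    unfold meshSum2
    congr 1; funext k
    rw [Measure.map_apply hf (measurableSet_Icc.prod measurableSet_Icc)]
  have hm1 : meshSum1 (Measure.map g ν) q r = ∑' k, mpow (ν (E k)) q := by
    unfold meshSum1
    congr 1; funext k
    rw [Measure.map_apply hg measurableSet_Icc]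
  rw [hm1, hm2]
  let Rel : ℤ × ℤ → ℤ → Prop := fun k j =>
    |(k.1 : ℝ) - (ε * j + s / δ)| ≤ 2 ∧ |(k.2 : ℝ) - s' / δ| ≤ R + 1
  let J : ℤ × ℤ → Finset ℤ := fun k => nearInts (ε * (k.1 - s / δ)) 2
  let J' : ℤ → Finset (ℤ × ℤ) := fun j => nearInts (ε * j + s / δ) 2 ×ˢ nearInts (s' / δ) (R + 1)
  have hJ : ∀ k j, Rel k j → j ∈ J k := by
    intro k j h
    simp only [J, mem_nearInts]
    have h := h.1
    rw [abs_le] at h ⊢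
    rcases hε with e | e <;> subst e <;> constructor <;> linarith [h.1, h.2]
  have hJ' : ∀ k j, Rel k j → k ∈ J' j := by
    intro k j h
    simp only [J', Finset.mem_product, mem_nearInts]
    exact h
  have hcJ : ∀ k, ((J k).card : ℝ) ≤ L := by
    intro k
    have := card_nearInts (ε * (k.1 - s / δ)) 2 (by norm_num)
    simp only [J]; linarith
  have hcJ' : ∀ j, ((J' j).card : ℝ) ≤ L := by
    intro j
    have a1 := card_nearInts (ε * j + s / δ) 2 (by norm_num)
    have a2 := card_nearInts (s' / δ) (R + 1) (by linarith)
    simp only [J', Finset.card_product]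
    push_cast
    rw [hL]
    exact mul_le_mul (by linarith) (by linarith) (by positivity) (by norm_num)
  have hrel : ∀ x ∈ K, ∀ k j, x ∈ Q k → x ∈ E j → Rel k j := by
    intro x hx k j hk hj
    simp only [hQ, hE, Set.mem_preimage, Set.mem_prod, Set.mem_Icc] at hk hj
    obtain ⟨⟨k1, k2⟩, k3, k4⟩ := hk
    obtain ⟨j1, j2⟩ := hj
    have e1 := h1 x hx
    have e2 := h2 x hx
    have j1' : (j : ℝ) * δ ≤ A * g x := by rw [← hrA]; nlinarith
    have j2' : A * g x ≤ (j + 1 : ℝ) * δ := by rw [← hrA]; nlinarith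
    constructor
    · have : (k.1 : ℝ) - (ε * j + s / δ) = (k.1 * δ - ε * (j * δ) - s) / δ := by field_simp; ring
      rw [this, abs_div, abs_of_pos hδ, div_le_iff₀ hδ, abs_le]
      rcases hε with e | e <;> subst e <;> constructor <;> linarith
    · have : (k.2 : ℝ) - s' / δ = (k.2 * δ - s') / δ := by field_simp
      rw [this, abs_div, abs_of_pos hδ, div_le_iff₀ hδ, abs_le]
      rw [abs_le] at e2
      constructor <;> linarith
  have hfl : ∀ (y t : ℝ), 0 < t → y ∈ Set.Icc ((⌊y / t⌋ : ℝ) * t) (((⌊y / t⌋ : ℝ) + 1) * t) := by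
    intro y t ht
    constructor
    · rw [← le_div_iff₀ ht]; exact Int.floor_le _
    · rw [← div_le_iff₀ ht]; exact (Int.lt_floor_add_one _).le
  have hnull : ∀ V : Set X, ν V ≤ ν (V ∩ K) := by
    intro V
    calc ν V ≤ ν ((V ∩ K) ∪ Kᶜ) := measure_mono (by
          intro x hx; by_cases h : x ∈ K
          · exact Or.inl ⟨hx, h⟩
          · exact Or.inr h)
      _ ≤ ν (V ∩ K) + ν Kᶜ := measure_union_le _ _
      _ = ν (V ∩ K) := by rw [hK, add_zero]
  have ha : ∀ k, ν (Q k) ≤ ∑ j ∈ (J k).filter (fun j => Rel k j), ν (E j) := by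
    intro k
    refine (hnull _).trans (le_trans (measure_mono ?_) (measure_biUnion_finset_le _ _))
    rintro x ⟨hxQ, hxK⟩
    have hxE : x ∈ E ⌊g x / r⌋ := hfl (g x) r hr0
    have hR' := hrel x hxK k _ hxQ hxE
    simp only [Set.mem_iUnion]
    exact ⟨_, Finset.mem_filter.2 ⟨hJ _ _ hR', hR'⟩, hxE⟩
  have hb : ∀ j, ν (E j) ≤ ∑ k ∈ (J' j).filter (fun k => Rel k j), ν (Q k) := by
    intro j
    refine (hnull _).trans (le_trans (measure_mono ?_) (measure_biUnion_finset_le _ _))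
    rintro x ⟨hxE, hxK⟩
    have hxQ : x ∈ Q (⌊(f x).1 / δ⌋, ⌊(f x).2 / δ⌋) :=
      ⟨hfl (f x).1 δ hδ, hfl (f x).2 δ hδ⟩
    have hR' := hrel x hxK _ j hxQ hxE
    simp only [Set.mem_iUnion]
    exact ⟨_, Finset.mem_filter.2 ⟨hJ' _ _ hR', hR'⟩, hxQ⟩
  have hT : ∀ j, ν (E j) ≠ 0 → j ∈ nearInts 0 (G / r + 1) := by
    intro j hj
    have : (E j ∩ K).Nonempty := by
      by_contra h
      rw [Set.not_nonempty_iff_eq_empty] at h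
      have := hnull (E j)
      rw [h] at this; simp at this
      exact hj this
    obtain ⟨x, hxE, hxK⟩ := this
    have g1 := abs_le.1 (hG x hxK)
    obtain ⟨j1, j2⟩ := hxE
    rw [mem_nearInts, sub_zero]
    have e : G / r * r = G := by field_simp
    rw [abs_le]
    constructor
    · by_contra h; push Not at h; nlinarith
    · by_contra h; push Not at h; nlinarith
  obtain ⟨⟨U, hU⟩, hle⟩ := tsum_compare_aux (fun k => ν (Q k)) (fun j => ν (E j))
    (fun j => measure_ne_top _ _) Rel J J' hJ' (fun k => by convert ha k) L hcJ hcJ' _ hT q hq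
  obtain ⟨-, hle'⟩ := tsum_compare_aux (fun j => ν (E j)) (fun k => ν (Q k))
    (fun j => measure_ne_top _ _) (fun j k => Rel k j) J' J (fun j k h => hJ k j h) (fun j => by convert hb j) L hcJ' hcJ
    U hU q hq
  exact ⟨hle', hle⟩

lemma meshSum2_swap_aux {X : Type*} [MeasurableSpace X] (ν : Measure X) (f : X → ℝ × ℝ)
    (hf : Measurable f) (q δ : ℝ) :
    meshSum2 (Measure.map (fun x => (f x).swap) ν) q δ = meshSum2 (Measure.map f ν) q δ := by
  unfold meshSum2
  rw [← (Equiv.prodComm ℤ ℤ).tsum_eq]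
  congr 1; funext k
  rw [Measure.map_apply hf (measurableSet_Icc.prod measurableSet_Icc),
    Measure.map_apply (show Measurable (fun x => (f x).swap) from measurable_swap.comp hf) (measurableSet_Icc.prod measurableSet_Icc)]
  congr 2
  ext x
  simp [and_comm]

lemma measurable_Sw_aux {ι : Type} (B : IFSData ι) (l : List ι) : Measurable (B.Sw l) := by
  induction l with
  | nil => exact measurable_id
  | cons i l ih =>
    have hS : Measurable (B.S i) := by
      unfold IFSData.S
      rcases B.swap i <;> simp only [Bool.false_eq_true, if_false, if_true] <;>
        exact Measurable.prodMk (by fun_prop) (by fun_prop)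
    exact hS.comp ih

lemma Sw_form_aux {ι : Type} (B : IFSData ι) (l : List ι) :
    ∃ ε1 ε2 s1 s2 : ℝ, (ε1 = 1 ∨ ε1 = -1) ∧ (ε2 = 1 ∨ ε2 = -1) ∧
      ∀ x, (B.Sw l x).1 = ε1 * (B.dims l).1 * (if B.swapW l then x.2 else x.1) + s1 ∧
        (B.Sw l x).2 = ε2 * (B.dims l).2 * (if B.swapW l then x.1 else x.2) + s2 := by
  induction l with
  | nil => exact ⟨1, 1, 0, 0, by simp, by simp, by simp [IFSData.Sw, IFSData.dims, IFSData.swapW]⟩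
  | cons i l ih =>
    obtain ⟨ε1, ε2, s1, s2, h1, h2, h⟩ := ih
    have e1 : ∀ x, B.Sw (i :: l) x = B.S i (B.Sw l x) := fun x => rfl
    have e2 : B.dims (i :: l) = (B.c i * (if B.swap i then (B.dims l).2 else (B.dims l).1),
      B.d i * (if B.swap i then (B.dims l).1 else (B.dims l).2)) := rfl
    have e3 : B.swapW (i :: l) = xor (B.swap i) (B.swapW l) := rfl
    have sg : ∀ b : Bool, ((if b then 1 else -1 : ℝ) = 1) ∨ ((if b then 1 else -1 : ℝ) = -1) := by
      intro b; cases b <;> simp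
    have pm : ∀ u v : ℝ, (u = 1 ∨ u = -1) → (v = 1 ∨ v = -1) → (u * v = 1 ∨ u * v = -1) := by
      rintro u v (rfl | rfl) (rfl | rfl) <;> simp
    simp only [e1, e2, e3, IFSData.S]
    cases hs : B.swap i
    · refine ⟨(if B.sgn1 i then 1 else -1) * ε1, (if B.sgn2 i then 1 else -1) * ε2,
        (if B.sgn1 i then 1 else -1) * (B.c i * s1) + (B.t i).1,
        (if B.sgn2 i then 1 else -1) * (B.d i * s2) + (B.t i).2,
        pm _ _ (sg _) h1, pm _ _ (sg _) h2, fun x => ?_⟩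
      obtain ⟨hx1, hx2⟩ := h x
      simp only [Bool.false_eq_true, if_false, Bool.false_xor, hx1, hx2]
      constructor <;> ring
    · refine ⟨(if B.sgn1 i then 1 else -1) * ε2, (if B.sgn2 i then 1 else -1) * ε1,
        (if B.sgn1 i then 1 else -1) * (B.c i * s2) + (B.t i).1,
        (if B.sgn2 i then 1 else -1) * (B.d i * s1) + (B.t i).2,
        pm _ _ (sg _) h2, pm _ _ (sg _) h1, fun x => ?_⟩
      obtain ⟨hx1, hx2⟩ := h x
      simp only [if_true, Bool.true_xor, hx1, hx2]
      cases B.swapW l <;>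
        simp only [Bool.false_eq_true, if_false, if_true, Bool.not_true, Bool.not_false] <;>
        constructor <;> ring

lemma dims_pos_aux {ι : Type} (B : IFSData ι)
    (hc : ∀ i, B.c i ∈ Set.Ioo (0 : ℝ) 1) (hd : ∀ i, B.d i ∈ Set.Ioo (0 : ℝ) 1) (l : List ι) :
    0 < (B.dims l).1 ∧ 0 < (B.dims l).2 := by
  induction l with
  | nil => simp [IFSData.dims]
  | cons i l ih =>
    have e2 : B.dims (i :: l) = (B.c i * (if B.swap i then (B.dims l).2 else (B.dims l).1),
      B.d i * (if B.swap i then (B.dims l).1 else (B.dims l).2)) := rfl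
    rw [e2]
    have h1 := (hc i).1
    have h2 := (hd i).1
    obtain ⟨h3, h4⟩ := ih
    cases B.swap i <;> simp <;> constructor <;> positivity

theorem mesh_sum_comparable_to_projected_mesh_sum
    {ι : Type} [Fintype ι] [Nonempty ι] (hcard : 2 ≤ Fintype.card ι)
    (B : IFSData ι)
    (hc : ∀ i, B.c i ∈ Set.Ioo (0 : ℝ) 1) (hd : ∀ i, B.d i ∈ Set.Ioo (0 : ℝ) 1)
    (p : ι → ℝ) (hp : ∀ i, p i ∈ Set.Ioo (0 : ℝ) 1) (hpsum : ∑ i : ι, p i = 1)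
    (μ : Measure (ℝ × ℝ)) [IsProbabilityMeasure μ]
    (hcpt : ∃ K : Set (ℝ × ℝ), IsCompact K ∧ μ Kᶜ = 0)
    (hself : μ = ∑ i : ι, ENNReal.ofReal (p i) • Measure.map (B.S i) μ)
    (τ1 τ2 : ℝ → ℝ)
    (hτ1 : ∀ q : ℝ, 0 ≤ q → IsLqSpec (Measure.map Prod.fst μ) q (τ1 q))
    (hτ2 : ∀ q : ℝ, 0 ≤ q → IsLqSpec (Measure.map Prod.snd μ) q (τ2 q))
     :
    ∀ q : ℝ, 0 ≤ q → ∃ c0 C : ℝ, 0 < c0 ∧ c0 ≤ C ∧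
      ∀ δ ∈ Set.Ioc (0 : ℝ) 1, ∀ l ∈ stopping B δ,
        c0 * meshSum1 (ENNReal.ofReal (wordProb p l) • Measure.map (B.projW l) μ) q
            (δ / B.alpha1 l) ≤
          meshSum2 (ENNReal.ofReal (wordProb p l) • Measure.map (B.Sw l) μ) q δ ∧
        meshSum2 (ENNReal.ofReal (wordProb p l) • Measure.map (B.Sw l) μ) q δ ≤
          C * meshSum1 (ENNReal.ofReal (wordProb p l) • Measure.map (B.projW l) μ) q
            (δ / B.alpha1 l) := by
  intro q hq
  obtain ⟨K, hKc, hK⟩ := hcpt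
  obtain ⟨R, hR0, hR⟩ : ∃ R : ℝ, 0 ≤ R ∧ ∀ x ∈ K, |x.1| ≤ R ∧ |x.2| ≤ R := by
    obtain ⟨R, hR⟩ := hKc.isBounded.exists_norm_le
    refine ⟨max R 0, le_max_right _ _, fun x hx => ?_⟩
    have h := hR x hx
    exact ⟨((norm_fst_le x).trans h).trans (le_max_left _ _),
      ((norm_snd_le x).trans h).trans (le_max_left _ _)⟩
  obtain ⟨L, hL⟩ : ∃ L : ℝ, L = 5 * (2 * R + 3) := ⟨_, rfl⟩
  have hL1 : 1 ≤ L := by linarith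
  have hC1 : 1 ≤ L ^ q * L := by
    have := Real.one_le_rpow hL1 hq
    nlinarith
  have hC0 : 0 < L ^ q * L := by linarith
  refine ⟨(L ^ q * L)⁻¹, L ^ q * L, by positivity, (inv_le_one_of_one_le₀ hC1).trans hC1, ?_⟩
  intro δ hδ l hl
  have hδ0 : 0 < δ := hδ.1
  have hα2 : B.alpha2 l < δ := hl.2.1
  set ν : Measure (ℝ × ℝ) := ENNReal.ofReal (wordProb p l) • μ with hν
  have : IsFiniteMeasure ν := by
    rw [hν]; exact Measure.smul_finite μ ENNReal.ofReal_ne_top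
  have hνK : ν Kᶜ = 0 := by rw [hν]; simp [hK]
  rw [← Measure.map_smul, ← Measure.map_smul, ← hν]
  rw [inv_mul_le_iff₀ hC0]
  obtain ⟨ε1, ε2, s1, s2, h1, h2, hform⟩ := Sw_form_aux B l
  obtain ⟨hb, hh⟩ := dims_pos_aux B hc hd l
  have hmS := measurable_Sw_aux B l
  have habs : ∀ ε u y s : ℝ, (ε = 1 ∨ ε = -1) → 0 < u → u ≤ δ → |y| ≤ R →
      |(ε * u * y + s) - s| ≤ R * δ := by
    intro ε u y s he hu0 hu hy
    have : |ε| = 1 := by rcases he with rfl | rfl <;> simp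
    rw [add_sub_cancel_right, abs_mul, abs_mul, this, one_mul, abs_of_pos hu0, mul_comm R δ]
    exact mul_le_mul hu hy (abs_nonneg _) hδ0.le
  have hmp : Measurable (B.projW l) := by
    unfold IFSData.projW
    split_ifs
    · exact measurable_fst
    · exact measurable_snd
  have hG : ∀ x ∈ K, |B.projW l x| ≤ R := by
    intro x hx
    unfold IFSData.projW
    split_ifs
    · exact (hR x hx).1
    · exact (hR x hx).2
  rcases le_or_gt (B.dims l).2 (B.dims l).1 with hle | hlt
  · have hα1 : B.alpha1 l = (B.dims l).1 := max_eq_left hle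
    have hα2' : B.alpha2 l = (B.dims l).2 := min_eq_right hle
    rw [hα1]
    refine core_compare ν K hνK (B.Sw l) (B.projW l) hmS hmp R hG δ _ ε1 s1 s2 R hδ0 hb h1 hR0
      ?_ ?_ q hq L hL
    · intro x hx
      rw [(hform x).1]
      unfold IFSData.projW IFSData.usesPi1
      cases B.swapW l <;> simp [hle, not_lt.2 hle]
    · intro x hx
      rw [(hform x).2]
      refine habs _ _ _ _ h2 hh (by linarith) ?_
      split_ifs
      · exact (hR x hx).1
      · exact (hR x hx).2
  · have hα1 : B.alpha1 l = (B.dims l).2 := max_eq_right hlt.le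
    have hα2' : B.alpha2 l = (B.dims l).1 := min_eq_left hlt.le
    rw [hα1, ← meshSum2_swap_aux ν (B.Sw l) hmS]
    refine core_compare ν K hνK (fun x => (B.Sw l x).swap) (B.projW l)
      (measurable_swap.comp hmS) hmp R hG δ _ ε2 s2 s1 R hδ0 hh h2 hR0
      ?_ ?_ q hq L hL
    · intro x hx
      rw [Prod.fst_swap, (hform x).2]
      unfold IFSData.projW IFSData.usesPi1
      cases B.swapW l <;> simp [hlt, not_le.2 hlt]
    · intro x hx
      rw [Prod.snd_swap, (hform x).1]
      refine habs _ _ _ _ h1 hb (by linarith) ?_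
      split_ifs
      · exact (hR x hx).2
      · exact (hR x hx).1
end
end

section
/- Let μ be of separated type. If τ_1 is differentiable at q > 0, then γ_A is differentiable at q with γ_A'(q) = −(Σ_{i∈I} p_i^q c_i^{τ_1(q)} d_i^{γ_A(q)−τ_1(q)} · log(p_i · c_i^{τ_1'(q)} · d_i^{−τ_1'(q)})) / (Σ_{i∈I} p_i^q c_i^{τ_1(q)} d_i^{γ_A(q)−τ_1(q)} · log d_i); and if τ_2 is differentiable at q > 0, then γ_B is differentiable at q with γ_B'(q) = −(Σ_{i∈I} p_i^q d_i^{τ_2(q)} c_i^{γ_B(q)−τ_2(q)} · log(p_i · d_i^{τ_2'(q)} · c_i^{−τ_2'(q)})) / (Σ_{i∈I} p_i^q d_i^{τ_2(q)} c_i^{γ_B(q)−τ_2(q)} · log c_i). -/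
open MeasureTheory Filter Set

attribute [local instance] Classical.propDecidable

noncomputable section

theorem implicit_aux {ι : Type} [Fintype ι] [Nonempty ι] (w : ι → ℝ → ℝ) (w' L : ι → ℝ) (q : ℝ)
    (h : ℝ → ℝ) (hw : ∀ i, HasDerivAt (w i) (w' i) q) (hpos : ∀ i x, 0 < w i x)
    (hL : ∀ i, L i < 0) (hq : h q = 0)
    (heq : ∀ᶠ x in nhds q, ∑ i : ι, w i x * Real.exp (h x * L i) = 1) :
    HasDerivAt h (-((∑ i : ι, w' i) / (∑ i : ι, w i q * L i))) q := by
  have h1 : ∑ i : ι, w i q = 1 := by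
    have := heq.self_of_nhds
    simpa [hq] using this
  have hcw : ∀ i, ContinuousAt (w i) q := fun i => (hw i).continuousAt
  have hcont : ContinuousAt h q := by
    have hcs : ∀ e : ℝ, ContinuousAt (fun x => ∑ i : ι, w i x * Real.exp (e * L i)) q := by
      intro e
      have : ∀ i ∈ (Finset.univ : Finset ι),
          Tendsto (fun x => w i x * Real.exp (e * L i)) (nhds q)
            (nhds (w i q * Real.exp (e * L i))) :=
        fun i _ => (hcw i).tendsto.mul_const _
      exact tendsto_finsetSum _ this
    have key : ∀ a b x : ℝ, a < b → 
        ∑ i : ι, w i x * Real.exp (b * L i) < ∑ i : ι, w i x * Real.exp (a * L i) := by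
      intro a b x hab
      apply Finset.sum_lt_sum_of_nonempty Finset.univ_nonempty
      intro i _
      apply mul_lt_mul_of_pos_left _ (hpos i x)
      exact Real.exp_lt_exp.2 (mul_lt_mul_of_neg_right hab (hL i))
    have key' : ∀ a b x : ℝ, a ≤ b → 
        ∑ i : ι, w i x * Real.exp (b * L i) ≤ ∑ i : ι, w i x * Real.exp (a * L i) := by
      intro a b x hab
      rcases hab.eq_or_lt with rfl | hab
      · exact le_rfl
      · exact (key a b x hab).le
    have h0 : ∑ i : ι, w i q * Real.exp (0 * L i) = 1 := by simpa using h1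
    rw [ContinuousAt, hq]
    refine tendsto_order.2 ⟨fun a ha => ?_, fun a ha => ?_⟩
    · have hlt := key a 0 q ha
      rw [h0] at hlt
      filter_upwards [(hcs a).eventually_const_lt hlt, heq] with x hx hxe
      by_contra hcon
      have := key' (h x) a x (not_lt.1 hcon)
      linarith
    · have hlt := key 0 a q ha
      rw [h0] at hlt
      filter_upwards [(hcs a).eventually_lt_const hlt, heq] with x hx hxe
      by_contra hcon
      have := key' a (h x) x (not_lt.1 hcon)
      linarith
  let k : ℝ → ℝ := dslope Real.exp 0
  have hk0 : k 0 = 1 := by simp [k, dslope_same]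
  have hkc : ContinuousAt k 0 := continuousAt_dslope_same.2 Real.differentiableAt_exp
  have hke : ∀ z, Real.exp z = 1 + z * k z := by
    intro z
    have := sub_smul_dslope Real.exp 0 z
    simp only [sub_zero, smul_eq_mul, Real.exp_zero] at this
    simp only [k]
    linarith
  let M : ℝ → ℝ := fun x => ∑ i : ι, w i x * (L i * k (h x * L i))
  have hMq : M q = ∑ i : ι, w i q * L i := by simp [M, hq, hk0]
  have hMneg : M q < 0 := by
    rw [hMq]
    apply Finset.sum_neg _ Finset.univ_nonempty
    exact fun i _ => mul_neg_of_pos_of_neg (hpos i q) (hL i)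
  have hMc : ContinuousAt M q := by
    have : ∀ i ∈ (Finset.univ : Finset ι),
          Tendsto (fun x => w i x * (L i * k (h x * L i))) (nhds q)
            (nhds (w i q * (L i * k (h q * L i)))) := by
      intro i _
      refine (hcw i).tendsto.mul (Tendsto.const_mul _ ?_)
      have e : ContinuousAt k (h q * L i) := by simpa [hq] using hkc
      exact e.tendsto.comp (hcont.tendsto.mul_const _)
    exact tendsto_finsetSum _ this
  let N : ℝ → ℝ := fun x => ∑ i : ι, w i x
  have hN : HasDerivAt N (∑ i : ι, w' i) q := HasDerivAt.fun_sum fun i _ => hw i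
  have hid : ∀ᶠ x in nhds q, N x + h x * M x = 1 := by
    filter_upwards [heq] with x hx
    rw [← hx]
    simp only [N, M, Finset.mul_sum, ← Finset.sum_add_distrib]
    refine Finset.sum_congr rfl fun i _ => ?_
    rw [hke (h x * L i)]
    ring
  rw [hasDerivAt_iff_tendsto_slope] at hN ⊢
  rw [← hMq]
  have hlim := (hN.div (hMc.tendsto.mono_left nhdsWithin_le_nhds) hMneg.ne).neg
  refine hlim.congr' ?_
  filter_upwards [hid.filter_mono nhdsWithin_le_nhds,
    (hMc.eventually_lt_const hMneg).filter_mono nhdsWithin_le_nhds,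
    self_mem_nhdsWithin] with x hx hMx hxq
  have hxq' : x - q ≠ 0 := sub_ne_zero.2 hxq
  have hM0 : M x ≠ 0 := hMx.ne
  have hNq : N q = 1 := h1
  simp only [Pi.div_apply, slope_def_field, hq, hNq, sub_zero]
  have : N x - 1 = - (h x * M x) := by linarith
  rw [this]
  field_simp

theorem gamma_aux {ι : Type} [Fintype ι] [Nonempty ι] (p c d : ι → ℝ)
    (hp : ∀ i, 0 < p i) (hc : ∀ i, 0 < c i) (hd : ∀ i, d i ∈ Set.Ioo (0 : ℝ) 1)
    (τ γ : ℝ → ℝ)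
    (hγ : ∀ q : ℝ, 0 ≤ q → ∑ i : ι, p i ^ q * c i ^ τ q * d i ^ (γ q - τ q) = 1)
    (q : ℝ) (hq : 0 < q) (D : ℝ) (hD : HasDerivAt τ D q) :
    HasDerivAt γ
      (-((∑ i : ι, p i ^ q * c i ^ τ q * d i ^ (γ q - τ q) *
            Real.log (p i * c i ^ D * d i ^ (-D))) /
         (∑ i : ι, p i ^ q * c i ^ τ q * d i ^ (γ q - τ q) * Real.log (d i)))) q := by
  have hd0 : ∀ i, 0 < d i := fun i => (hd i).1
  have main := implicit_aux (fun i x => p i ^ x * c i ^ τ x * d i ^ (γ q - τ x))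
    (fun i => p i ^ q * c i ^ τ q * d i ^ (γ q - τ q) *
            Real.log (p i * c i ^ D * d i ^ (-D))) (fun i => Real.log (d i)) q
    (fun x => γ x - γ q) ?_ ?_ ?_ (sub_self _) ?_
  · simpa using main.add_const (γ q)
  · intro i
    have a1 := (hasDerivAt_id q).const_rpow (hp i)
    have a2 := hD.const_rpow (hc i)
    have a3 := (hD.const_sub (γ q)).const_rpow (hd0 i)
    refine ((a1.mul a2).mul a3).congr_deriv ?_
    rw [Real.log_mul (mul_pos (hp i) (Real.rpow_pos_of_pos (hc i) _)).ne'
      (Real.rpow_pos_of_pos (hd0 i) _).ne', Real.log_mul (hp i).ne'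
      (Real.rpow_pos_of_pos (hc i) _).ne', Real.log_rpow (hc i), Real.log_rpow (hd0 i)]
    simp only [id, Pi.mul_apply]
    ring
  · intro i x
    have := Real.rpow_pos_of_pos (hp i) x
    have := Real.rpow_pos_of_pos (hc i) (τ x)
    have := Real.rpow_pos_of_pos (hd0 i) (γ q - τ x)
    positivity
  · exact fun i => Real.log_neg (hd i).1 (hd i).2
  · filter_upwards [lt_mem_nhds hq] with x hx
    rw [← hγ x hx.le]
    refine Finset.sum_congr rfl fun i _ => ?_
    have : Real.exp ((γ x - γ q) * Real.log (d i)) = d i ^ (γ x - γ q) := by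
      rw [Real.rpow_def_of_pos (hd0 i), mul_comm]
    rw [this, mul_assoc _ (d i ^ _) (d i ^ _), ← Real.rpow_add (hd0 i)]
    congr 2
    ring

theorem derivatives_of_gammaA_gammaB
    {ι : Type} [Fintype ι] [Nonempty ι] (hcard : 2 ≤ Fintype.card ι)
    (B : IFSData ι)
    (hc : ∀ i, B.c i ∈ Set.Ioo (0 : ℝ) 1) (hd : ∀ i, B.d i ∈ Set.Ioo (0 : ℝ) 1)
    (p : ι → ℝ) (hp : ∀ i, p i ∈ Set.Ioo (0 : ℝ) 1) (hpsum : ∑ i : ι, p i = 1)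
    (μ : Measure (ℝ × ℝ)) [IsProbabilityMeasure μ]
    (hcpt : ∃ K : Set (ℝ × ℝ), IsCompact K ∧ μ Kᶜ = 0)
    (hself : μ = ∑ i : ι, ENNReal.ofReal (p i) • Measure.map (B.S i) μ)
    (τ1 τ2 : ℝ → ℝ)
    (hτ1 : ∀ q : ℝ, 0 ≤ q → IsLqSpec (Measure.map Prod.fst μ) q (τ1 q))
    (hτ2 : ∀ q : ℝ, 0 ≤ q → IsLqSpec (Measure.map Prod.snd μ) q (τ2 q))
    (hsep : ∀ i, B.swap i = false)
    (γA γB : ℝ → ℝ)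
    (hγA : ∀ q : ℝ, 0 ≤ q → ∑ i : ι, p i ^ q * B.c i ^ τ1 q * B.d i ^ (γA q - τ1 q) = 1)
    (hγB : ∀ q : ℝ, 0 ≤ q → ∑ i : ι, p i ^ q * B.d i ^ τ2 q * B.c i ^ (γB q - τ2 q) = 1)
     :
    ∀ q : ℝ, 0 < q →
      (∀ D1 : ℝ, HasDerivAt τ1 D1 q →
        HasDerivAt γA
          (-((∑ i : ι, p i ^ q * B.c i ^ τ1 q * B.d i ^ (γA q - τ1 q) *
                Real.log (p i * B.c i ^ D1 * B.d i ^ (-D1))) /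
             (∑ i : ι, p i ^ q * B.c i ^ τ1 q * B.d i ^ (γA q - τ1 q) * Real.log (B.d i)))) q) ∧
      (∀ D2 : ℝ, HasDerivAt τ2 D2 q →
        HasDerivAt γB
          (-((∑ i : ι, p i ^ q * B.d i ^ τ2 q * B.c i ^ (γB q - τ2 q) *
                Real.log (p i * B.d i ^ D2 * B.c i ^ (-D2))) /
             (∑ i : ι, p i ^ q * B.d i ^ τ2 q * B.c i ^ (γB q - τ2 q) * Real.log (B.c i)))) q) := by
  intro q hq
  exact ⟨fun D hD => gamma_aux p B.c B.d (fun i => (hp i).1) (fun i => (hc i).1) hd τ1 γA hγA q hq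
      D hD,
    fun D hD => gamma_aux p B.d B.c (fun i => (hp i).1) (fun i => (hd i).1) hc τ2 γB hγB q hq D hD⟩
end
end

section
/- Let μ be of separated type. (1) For every q ≥ 0, either max{γ_A(q), γ_B(q)} ≤ τ_1(q)+τ_2(q) or min{γ_A(q), γ_B(q)} ≥ τ_1(q)+τ_2(q). (2) If τ_1 and τ_2 are differentiable at 1 (so that γ_A and γ_B are differentiable at 1), then either max{γ_A'(1), γ_B'(1)} ≤ τ_1'(1)+τ_2'(1) or min{γ_A'(1), γ_B'(1)} ≥ τ_1'(1)+τ_2'(1). -/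
open MeasureTheory Filter Set

attribute [local instance] Classical.propDecidable

noncomputable section

theorem aux_deriv (F : ℝ → ℝ → ℝ) (g : ℝ → ℝ) (X N : ℝ) (hN : N < 0)
    (hanti : ∀ q, StrictAnti (F q)) (hF : ∀ q, 0 ≤ q → F q (g q) = 1) (h1 : F 1 0 = 1)
    (hder : ∀ k : ℝ, HasDerivAt (fun q => F q (k * (q - 1))) (X + k * N) 1) :
    HasDerivAt g (-X / N) 1 := by
  have hg1 : g 1 = 0 := (hanti 1).injective ((hF 1 zero_le_one).trans h1.symm)
  rw [hasDerivAt_iff_isLittleO, Asymptotics.isLittleO_iff]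
  intro ε hε
  have hKN : -X / N * N = -X := div_mul_cancel₀ _ hN.ne
  have e1 := (hasDerivAt_iff_tendsto_slope.1 (hder (-X / N + ε))).eventually
    (Iio_mem_nhds (show X + (-X / N + ε) * N < 0 by nlinarith))
  have e2 := (hasDerivAt_iff_tendsto_slope.1 (hder (-X / N - ε))).eventually
    (Ioi_mem_nhds (show 0 < X + (-X / N - ε) * N by nlinarith))
  rw [eventually_nhdsWithin_iff] at e1 e2
  have e3 : ∀ᶠ q : ℝ in nhds 1, 0 < q := Ioi_mem_nhds zero_lt_one
  filter_upwards [e1, e2, e3] with q a1 a2 hq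
  simp only [hg1, smul_eq_mul, Real.norm_eq_abs, sub_zero]
  have hFq := hF q hq.le
  rcases lt_trichotomy q 1 with h | h | h
  · have b1 := a1 (by simp [h.ne])
    have b2 := a2 (by simp [h.ne])
    simp only [slope_def_field, sub_self, mul_zero, h1, Set.mem_Iio, Set.mem_Ioi] at b1 b2
    rw [div_neg_iff] at b1
    rw [div_pos_iff] at b2
    have c1 : F q (g q) < F q ((-X / N + ε) * (q - 1)) := by
      rcases b1 with b | b <;> linarith
    have c2 : F q ((-X / N - ε) * (q - 1)) < F q (g q) := by
      rcases b2 with b | b <;> linarith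
    rw [(hanti q).lt_iff_gt] at c1 c2
    rw [abs_of_neg (sub_neg.2 h), abs_le]
    constructor <;> linarith
  · subst h
    simp [hg1]
  · have b1 := a1 (by simp [h.ne'])
    have b2 := a2 (by simp [h.ne'])
    simp only [slope_def_field, sub_self, mul_zero, h1, Set.mem_Iio, Set.mem_Ioi] at b1 b2
    rw [div_neg_iff] at b1
    rw [div_pos_iff] at b2
    have c1 : F q ((-X / N + ε) * (q - 1)) < F q (g q) := by
      rcases b1 with b | b <;> linarith
    have c2 : F q (g q) < F q ((-X / N - ε) * (q - 1)) := by
      rcases b2 with b | b <;> linarith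
    rw [(hanti q).lt_iff_gt] at c1 c2
    rw [abs_of_pos (sub_pos.2 h), abs_le]
    constructor <;> linarith

theorem aux_anti {ι : Type} [Fintype ι] [Nonempty ι] (w d : ι → ℝ) (hw : ∀ i, 0 < w i)
    (hd : ∀ i, d i ∈ Set.Ioo (0 : ℝ) 1) : StrictAnti fun y : ℝ => ∑ i, w i * d i ^ y := by
  intro x y hxy
  apply Finset.sum_lt_sum_of_nonempty Finset.univ_nonempty
  intro i _
  exact mul_lt_mul_of_pos_left (Real.rpow_lt_rpow_of_exponent_gt (hd i).1 (hd i).2 hxy) (hw i)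

theorem aux_log {ι : Type} [Fintype ι] [Nonempty ι] (p d : ι → ℝ) (hp : ∀ i, p i ∈ Set.Ioo (0 : ℝ) 1)
    (hd : ∀ i, d i ∈ Set.Ioo (0 : ℝ) 1) : ∑ i, p i * Real.log (d i) < 0 :=
  Finset.sum_neg (fun i _ => mul_neg_of_pos_of_neg (hp i).1 (Real.log_neg (hd i).1 (hd i).2))
    Finset.univ_nonempty

theorem aux_gamma {ι : Type} [Fintype ι] [Nonempty ι] (p c d : ι → ℝ)
    (hp : ∀ i, p i ∈ Set.Ioo (0 : ℝ) 1) (hpsum : ∑ i : ι, p i = 1)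
    (hc : ∀ i, c i ∈ Set.Ioo (0 : ℝ) 1) (hd : ∀ i, d i ∈ Set.Ioo (0 : ℝ) 1)
    (τ γ : ℝ → ℝ) (hτ : τ 1 = 0) (D : ℝ) (hD : HasDerivAt τ D 1)
    (hγ : ∀ q : ℝ, 0 ≤ q → ∑ i : ι, p i ^ q * c i ^ τ q * d i ^ (γ q - τ q) = 1) :
    HasDerivAt γ (-(∑ i, p i * Real.log (p i) + D * ∑ i, p i * Real.log (c i)) /
      (∑ i, p i * Real.log (d i)) + D) 1 := by
  have key := aux_deriv (fun q y => ∑ i, p i ^ q * c i ^ τ q * d i ^ y) (fun q => γ q - τ q)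
    (∑ i, p i * Real.log (p i) + D * ∑ i, p i * Real.log (c i)) (∑ i, p i * Real.log (d i))
    (aux_log p d hp hd)
    (fun q => aux_anti _ _ (fun i => mul_pos (Real.rpow_pos_of_pos (hp i).1 _)
      (Real.rpow_pos_of_pos (hc i).1 _)) hd) hγ (by simpa [hτ] using hpsum) ?_
  · have := key.add hD
    have e : (fun q => γ q - τ q) + τ = γ := by
      ext q
      simp
    rwa [e] at this
  · intro k
    have hk : HasDerivAt (fun q : ℝ => k * (q - 1)) k 1 := by
      simpa using ((hasDerivAt_id (1 : ℝ)).sub_const 1).const_mul k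
    have h := HasDerivAt.fun_sum (u := Finset.univ) (fun i _ =>
      (((hasDerivAt_id (1 : ℝ)).const_rpow (hp i).1).mul (hD.const_rpow (hc i).1)).mul
        (hk.const_rpow (hd i).1))
    refine HasDerivAt.congr_deriv h ?_
    simp only [hτ, id, Pi.mul_apply, Real.rpow_one, Real.rpow_zero, sub_self, mul_zero, mul_one,
      Finset.mul_sum, ← Finset.sum_add_distrib]
    apply Finset.sum_congr rfl
    intro i _
    ring

theorem aux_spec (ν : Measure ℝ) [IsProbabilityMeasure ν] (t : ℝ) (h : IsLqSpec ν 1 t) :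
    t = 0 := by
  rw [← h.1]
  simp [lowerLq]

theorem aux_part1 {ι : Type} [Fintype ι] [Nonempty ι] (w d : ι → ℝ) (hw : ∀ i, 0 < w i)
    (hd : ∀ i, d i ∈ Set.Ioo (0 : ℝ) 1) (a b g : ℝ) (h : ∑ i, w i * d i ^ (g - a) = 1) :
    (∑ i, w i * d i ^ b ≤ 1 ↔ g ≤ a + b) ∧ (1 ≤ ∑ i, w i * d i ^ b ↔ a + b ≤ g) := by
  have hA := aux_anti w d hw hd
  rw [← h]
  have h1 := hA.le_iff_ge (a := b) (b := g - a)
  have h2 := hA.le_iff_ge (a := g - a) (b := b)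
  refine ⟨h1.trans ?_, h2.trans ?_⟩
  all_goals constructor <;> intro <;> linarith

theorem gammaA_gammaB_not_separated_by_tau_sum
    {ι : Type} [Fintype ι] [Nonempty ι] (hcard : 2 ≤ Fintype.card ι)
    (B : IFSData ι)
    (hc : ∀ i, B.c i ∈ Set.Ioo (0 : ℝ) 1) (hd : ∀ i, B.d i ∈ Set.Ioo (0 : ℝ) 1)
    (p : ι → ℝ) (hp : ∀ i, p i ∈ Set.Ioo (0 : ℝ) 1) (hpsum : ∑ i : ι, p i = 1)
    (μ : Measure (ℝ × ℝ)) [IsProbabilityMeasure μ]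
    (hcpt : ∃ K : Set (ℝ × ℝ), IsCompact K ∧ μ Kᶜ = 0)
    (hself : μ = ∑ i : ι, ENNReal.ofReal (p i) • Measure.map (B.S i) μ)
    (τ1 τ2 : ℝ → ℝ)
    (hτ1 : ∀ q : ℝ, 0 ≤ q → IsLqSpec (Measure.map Prod.fst μ) q (τ1 q))
    (hτ2 : ∀ q : ℝ, 0 ≤ q → IsLqSpec (Measure.map Prod.snd μ) q (τ2 q))
    (hsep : ∀ i, B.swap i = false)
    (γA γB : ℝ → ℝ)
    (hγA : ∀ q : ℝ, 0 ≤ q → ∑ i : ι, p i ^ q * B.c i ^ τ1 q * B.d i ^ (γA q - τ1 q) = 1)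
    (hγB : ∀ q : ℝ, 0 ≤ q → ∑ i : ι, p i ^ q * B.d i ^ τ2 q * B.c i ^ (γB q - τ2 q) = 1)
     :
    (∀ q : ℝ, 0 ≤ q →
        max (γA q) (γB q) ≤ τ1 q + τ2 q ∨ τ1 q + τ2 q ≤ min (γA q) (γB q)) ∧
    (∀ D1 D2 : ℝ, HasDerivAt τ1 D1 1 → HasDerivAt τ2 D2 1 →
        ∃ DA DB : ℝ, HasDerivAt γA DA 1 ∧ HasDerivAt γB DB 1 ∧
          (max DA DB ≤ D1 + D2 ∨ D1 + D2 ≤ min DA DB)) := by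
  constructor
  · intro q hq
    have hA := aux_part1 (fun i => p i ^ q * B.c i ^ τ1 q) B.d (fun i => mul_pos
      (Real.rpow_pos_of_pos (hp i).1 _) (Real.rpow_pos_of_pos (hc i).1 _)) hd _ (τ2 q) _ (hγA q hq)
    have hB := aux_part1 (fun i => p i ^ q * B.d i ^ τ2 q) B.c (fun i => mul_pos
      (Real.rpow_pos_of_pos (hp i).1 _) (Real.rpow_pos_of_pos (hd i).1 _)) hc _ (τ1 q) _ (hγB q hq)
    have e : ∑ i, p i ^ q * B.d i ^ τ2 q * B.c i ^ τ1 q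
        = ∑ i, p i ^ q * B.c i ^ τ1 q * B.d i ^ τ2 q :=
      Finset.sum_congr rfl fun i _ => by ring
    simp only [e, add_comm (τ2 q) (τ1 q)] at hA hB
    rcases le_total (∑ i, p i ^ q * B.c i ^ τ1 q * B.d i ^ τ2 q) 1 with h | h
    · exact Or.inl (max_le (hA.1.1 h) (hB.1.1 h))
    · exact Or.inr (le_min (hA.2.1 h) (hB.2.1 h))
  · intro D1 D2 h1 h2
    have : IsProbabilityMeasure (Measure.map (Prod.fst : ℝ × ℝ → ℝ) μ) :=
      Measure.isProbabilityMeasure_map measurable_fst.aemeasurable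
    have : IsProbabilityMeasure (Measure.map (Prod.snd : ℝ × ℝ → ℝ) μ) :=
      Measure.isProbabilityMeasure_map measurable_snd.aemeasurable
    have t1 := aux_spec _ _ (hτ1 1 zero_le_one)
    have t2 := aux_spec _ _ (hτ2 1 zero_le_one)
    refine ⟨_, _, aux_gamma p B.c B.d hp hpsum hc hd τ1 γA t1 D1 h1 hγA,
      aux_gamma p B.d B.c hp hpsum hd hc τ2 γB t2 D2 h2 hγB, ?_⟩
    have nc := aux_log p B.c hp hc
    have nd := aux_log p B.d hp hd
    generalize ∑ i, p i * Real.log (B.c i) = C at *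
    generalize ∑ i, p i * Real.log (B.d i) = E at *
    generalize ∑ i, p i * Real.log (p i) = P at *
    have eA : -(P + D1 * C) / E + D1 = D1 + D2 - (P + D1 * C + D2 * E) / E := by
      field_simp [nd.ne]; ring
    have eB : -(P + D2 * E) / C + D2 = D1 + D2 - (P + D1 * C + D2 * E) / C := by
      field_simp [nc.ne]; ring
    rw [eA, eB]
    rcases le_total (P + D1 * C + D2 * E) 0 with h | h
    · left
      have := div_nonneg_of_nonpos h nd.le
      have := div_nonneg_of_nonpos h nc.le
      apply max_le <;> linarith
    · right
      have := div_nonpos_of_nonneg_of_nonpos h nd.le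
      have := div_nonpos_of_nonneg_of_nonpos h nc.le
      apply le_min <;> linarith
end
end
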